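/- arXiv:0910.0641 — 2 statements merged into one kernel-verified Lean document; each statement's English description precedes it below -/
import Mathlib

section
/- There exists a constant ε₁ > 0 such that for all integers d ≥ 0 and n ≥ d+1 and every function f : F₂ⁿ → F₂, the rejection probability of the (d+1)-flat test satisfies Rej_{d,d+1}(f) ≥ min{2^d · δ_d(f), ε₁}. -/
open scoped Classical

noncomputable section

/-- `f : 𝔽₂ⁿ → 𝔽₂` has degree at most `d` (as a multilinear polynomial). -/
def degLE (n d : ℕ) (f : (Fin n → ZMod 2) → ZMod 2) : Prop :=
  ∃ p : MvPolynomial (Fin n) (ZMod 2), p.totalDegree ≤ d ∧ ∀ x, MvPolynomial.eval x p = f x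

/-- fractional Hamming distance between two functions on 𝔽₂ⁿ. -/
def hdist (n : ℕ) (f g : (Fin n → ZMod 2) → ZMod 2) : ℝ :=
  ((Finset.univ.filter fun x => f x ≠ g x).card : ℝ) / 2 ^ n

/-- distance of `f` to the Reed–Muller code RM(d,n). -/
def deltaD (n d : ℕ) (f : (Fin n → ZMod 2) → ZMod 2) : ℝ :=
  sInf {r : ℝ | ∃ g, degLE n d g ∧ r = hdist n f g}

/-- Rejection probability of the `k`-flat test: a uniformly random `k`-flat is chosen
(via a uniformly random injective affine parametrization `u ↦ M u + b`), and the test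
rejects iff the restriction of `f` does not have degree at most `d`. -/
def Rej (n d k : ℕ) (f : (Fin n → ZMod 2) → ZMod 2) : ℝ :=
  ((Finset.univ.filter fun Mb : Matrix (Fin n) (Fin k) (ZMod 2) × (Fin n → ZMod 2) =>
      Function.Injective Mb.1.mulVec ∧
        ¬ degLE k d (fun u => f (Mb.1.mulVec u + Mb.2))).card : ℝ) /
  ((Finset.univ.filter fun Mb : Matrix (Fin n) (Fin k) (ZMod 2) × (Fin n → ZMod 2) =>
      Function.Injective Mb.1.mulVec).card : ℝ)

/-- Rejection probability of the (d+1)-fold derivative (Gowers norm) test. -/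
def Rej0 (n d : ℕ) (f : (Fin n → ZMod 2) → ZMod 2) : ℝ :=
  ((Finset.univ.filter fun xa : (Fin n → ZMod 2) × (Fin (d+1) → Fin n → ZMod 2) =>
      (∑ S : Finset (Fin (d+1)), f (xa.1 + ∑ i ∈ S, xa.2 i)) = 1).card : ℝ) /
  ((2 ^ n) * (2 ^ n) ^ (d+1) : ℝ)

/-- the (d+1)-st Gowers norm of `f`. -/
def gowersNorm (n d : ℕ) (f : (Fin n → ZMod 2) → ZMod 2) : ℝ :=
  (1 - 2 * Rej0 n d f) ^ ((1 : ℝ) / 2 ^ (d+1))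

/-- t-fold XOR of `f`, as a function on 𝔽₂^(t·n). -/
def xorPow (n t : ℕ) (f : (Fin n → ZMod 2) → ZMod 2) :
    (Fin (t * n) → ZMod 2) → ZMod 2 :=
  fun x => ∑ i : Fin t, f fun j => x (finProdFinEquiv (i, j))

/-- elementary symmetric polynomial of degree m on n variables over 𝔽₂. -/
def symPoly (n m : ℕ) : (Fin n → ZMod 2) → ZMod 2 :=
  fun x => ∑ I ∈ Finset.powersetCard m Finset.univ, ∏ i ∈ I, x i

/-- the hyperplane `{x : L·x = b}`. -/
def hyp (n : ℕ) (L : Fin n → ZMod 2) (b : ZMod 2) : Set (Fin n → ZMod 2) :=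
  {x | ∑ i, L i * x i = b}


namespace ReedMuller

section Derivative

variable {V : Type} [AddCommGroup V]

/-- The discrete derivative of `f` in direction `y`. -/
def fdiff (y : V) (f : V → ZMod 2) : V → ZMod 2 := fun x => f (x + y) + f x

/-- `DegLT m f`: all `m`-fold discrete derivatives of `f` vanish, i.e. `f` has degree `< m`. -/
def DegLT : ℕ → (V → ZMod 2) → Prop
  | 0, f => ∀ x, f x = 0
  | m + 1, f => ∀ y, DegLT m (fdiff y f)

lemma fdiff_add (y : V) (f g : V → ZMod 2) : fdiff y (f + g) = fdiff y f + fdiff y g := by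
  funext x
  simp only [fdiff, Pi.add_apply]
  ring

lemma fdiff_comm (y z : V) (f : V → ZMod 2) : fdiff y (fdiff z f) = fdiff z (fdiff y f) := by
  funext x
  simp only [fdiff, add_right_comm x z y]
  ring

lemma fdiff_add_dir (y z : V) (f : V → ZMod 2) :
    fdiff (y + z) f = (fun x => fdiff z f (x + y)) + fdiff y f := by
  funext x
  simp only [fdiff, Pi.add_apply, ← add_assoc]
  linear_combination -(CharTwo.add_self_eq_zero (f (x + y)))

lemma fdiff_zero_dir (f : V → ZMod 2) : fdiff 0 f = 0 := by
  funext x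
  simp [fdiff, CharTwo.add_self_eq_zero]

lemma DegLT.zero (m : ℕ) : DegLT m (0 : V → ZMod 2) := by
  induction m with
  | zero => intro x; rfl
  | succ m ih =>
    intro y
    have : fdiff y (0 : V → ZMod 2) = 0 := by funext x; simp [fdiff]
    rw [this]; exact ih

lemma DegLT.add {m : ℕ} {f g : V → ZMod 2} (hf : DegLT m f) (hg : DegLT m g) :
    DegLT m (f + g) := by
  induction m generalizing f g with
  | zero => intro x; simp [hf x, hg x]
  | succ m ih => intro y; rw [fdiff_add]; exact ih (hf y) (hg y)

lemma DegLT.succ {m : ℕ} {f : V → ZMod 2} (hf : DegLT m f) : DegLT (m + 1) f := by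
  induction m generalizing f with
  | zero => intro y x; simp [fdiff, hf _]
  | succ m ih => intro y; exact ih (hf y)

lemma DegLT.mono {m k : ℕ} (h : m ≤ k) {f : V → ZMod 2} (hf : DegLT m f) : DegLT k f := by
  induction k, h using Nat.le_induction with
  | base => exact hf
  | succ k _ ih => exact ih.succ

lemma DegLT.comp_affine {W : Type} [AddCommGroup W] {m : ℕ} {f : V → ZMod 2} (hf : DegLT m f)
    (φ : W → V) (L : W → V) (hφ : ∀ x y, φ (x + y) = φ x + L y) : DegLT m (f ∘ φ) := by
  induction m generalizing f with
  | zero => intro x; exact hf _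
  | succ m ih =>
    intro y
    have : fdiff y (f ∘ φ) = fdiff (L y) f ∘ φ := by funext x; simp [fdiff, hφ]
    rw [this]; exact ih (hf _)

lemma DegLT.translate {m : ℕ} {f : V → ZMod 2} (hf : DegLT m f) (y : V) :
    DegLT m (fun x => f (x + y)) :=
  hf.comp_affine (fun x => x + y) id fun x z => by simp [add_right_comm]

/-- Multiplying by an affine function raises the degree by at most one. -/
lemma DegLT.affine_mul {m : ℕ} {f : V → ZMod 2} (hf : DegLT m f) (a l : V → ZMod 2)
    (ha : ∀ x y, a (x + y) = a x + l y) : DegLT (m + 1) (fun x => a x * f x) := by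
  induction m generalizing f with
  | zero => intro y x; simp [fdiff, hf _]
  | succ m ih =>
    intro y
    have h1 : fdiff y (fun x => a x * f x)
        = (fun x => a x * fdiff y f x) + fun x => l y * f (x + y) := by
      funext x
      simp only [fdiff, ha, Pi.add_apply]
      ring
    rw [h1]
    refine (ih (hf y)).add ?_
    have h2 : l y = 0 ∨ l y = 1 := by generalize l y = t; revert t; decide
    rcases h2 with h2 | h2
    · simp only [h2, zero_mul]; exact DegLT.zero _
    · simp only [h2, one_mul]; exact hf.translate y

end Derivative

section Counting

variable {V : Type} [AddCommGroup V] [Fintype V]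

/-- The indicator of being nonzero. -/
def ind (a : ZMod 2) : ℝ := if a = 0 then 0 else 1

lemma zmod_two_cases (t : ZMod 2) : t = 0 ∨ t = 1 := by
  revert t; decide

lemma ind_zero : ind 0 = 0 := by simp [ind]

lemma ind_one : ind 1 = 1 := by simp [ind]

lemma ind_nonneg (a : ZMod 2) : 0 ≤ ind a := by
  rcases zmod_two_cases a with rfl | rfl <;> simp [ind]

lemma ind_add (a b : ZMod 2) : ind (a + b) = ind a + ind b - 2 * (ind a * ind b) := by
  rcases zmod_two_cases a with rfl | rfl <;> rcases zmod_two_cases b with rfl | rfl <;>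
    (simp [ind, CharTwo.add_self_eq_zero]; try norm_num)

/-- The number of points where `f` does not vanish, as a real number. -/
def wt {V : Type} [Fintype V] (f : V → ZMod 2) : ℝ := ∑ x, ind (f x)

lemma wt_nonneg {V : Type} [Fintype V] (f : V → ZMod 2) : 0 ≤ wt f :=
  Finset.sum_nonneg fun _ _ => ind_nonneg _

lemma wt_eq_card {V : Type} [Fintype V] (f : V → ZMod 2) :
    wt f = ((Finset.univ.filter fun x => f x ≠ 0).card : ℝ) := by
  simp [wt, ind, Finset.card_filter]

/-- The number of tuples `(x, y₁, …, yₘ)` at which the `m`-fold derivative of `f` is nonzero. -/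
def rejCount : ℕ → (V → ZMod 2) → ℝ
  | 0, f => wt f
  | m + 1, f => ∑ y, rejCount m (fdiff y f)

lemma sum_comp_add_right (y : V) (g : V → ℝ) : ∑ x, g (x + y) = ∑ x, g x :=
  Fintype.sum_equiv (Equiv.addRight y) _ _ fun _ => rfl

lemma wt_fdiff_le (y : V) (f : V → ZMod 2) : wt (fdiff y f) ≤ 2 * wt f := by
  calc wt (fdiff y f) ≤ ∑ x, (ind (f (x + y)) + ind (f x)) := by
        refine Finset.sum_le_sum fun x _ => ?_
        rw [fdiff, ind_add]
        have := mul_nonneg (ind_nonneg (f (x + y))) (ind_nonneg (f x))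
        linarith
    _ = 2 * wt f := by
        rw [Finset.sum_add_distrib, sum_comp_add_right y (fun x => ind (f x)), two_mul]
        rfl

lemma sum_wt_fdiff (f : V → ZMod 2) :
    ∑ y, wt (fdiff y f) = 2 * wt f * Fintype.card V - 2 * wt f ^ 2 := by
  have h1 : ∀ x, ∑ y, ind (f (x + y)) = wt f := fun x =>
    Fintype.sum_equiv (Equiv.addLeft x) _ _ fun _ => rfl
  have h2 : ∑ x, ind (f x) = wt f := rfl
  simp only [wt.eq_1 (fdiff _ f)]
  rw [Finset.sum_comm]
  simp only [fdiff, ind_add, Finset.sum_sub_distrib, Finset.sum_add_distrib, ← Finset.mul_sum,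
    ← Finset.sum_mul, h1, h2, Finset.sum_const, Finset.card_univ, nsmul_eq_mul]
  ring

lemma rejCount_nonneg (m : ℕ) (f : V → ZMod 2) : 0 ≤ rejCount m f := by
  induction m generalizing f with
  | zero => exact wt_nonneg f
  | succ m ih => exact Finset.sum_nonneg fun y _ => ih _

lemma rejCount_add {m : ℕ} (f : V → ZMod 2) {g : V → ZMod 2} (hg : DegLT m g) :
    rejCount m (f + g) = rejCount m f := by
  induction m generalizing f g with
  | zero =>
    have : g = 0 := funext hg
    rw [this, add_zero]
  | succ m ih =>
    refine Finset.sum_congr rfl fun y _ => ?_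
    rw [fdiff_add]; exact ih _ (hg y)

lemma rejCount_zero_fun (m : ℕ) : rejCount m (0 : V → ZMod 2) = 0 := by
  induction m with
  | zero => simp [rejCount, wt, ind_zero]
  | succ m ih =>
    refine Finset.sum_eq_zero fun y _ => ?_
    have : fdiff y (0 : V → ZMod 2) = 0 := by funext x; simp [fdiff]
    rw [this]; exact ih

lemma card_pos_real (V : Type) [AddCommGroup V] [Fintype V] : (0 : ℝ) < Fintype.card V := by
  exact_mod_cast Fintype.card_pos

/-- Second-moment lower bound for the rejection count of a function of small support. -/
lemma le_rejCount_of_wt (m : ℕ) (f : V → ZMod 2) :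
    (Fintype.card V : ℝ) ^ m * (2 ^ m * wt f - (4 ^ m - 2 ^ m) * wt f ^ 2 / Fintype.card V)
      ≤ rejCount m f := by
  have hN := card_pos_real V
  induction m generalizing f with
  | zero => simp [rejCount]
  | succ m ih =>
    set N : ℝ := (Fintype.card V : ℝ) with hNdef
    have h42 : (0 : ℝ) ≤ 4 ^ m - 2 ^ m := by
      have : (2 : ℝ) ^ m ≤ 4 ^ m := pow_le_pow_left₀ (by norm_num) (by norm_num) m
      linarith
    have h1 : ∀ y, N ^ m * (2 ^ m * wt (fdiff y f) - (4 ^ m - 2 ^ m) * (2 * wt f) ^ 2 / N)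
        ≤ rejCount m (fdiff y f) := by
      intro y
      refine le_trans ?_ (ih _)
      have h2 : wt (fdiff y f) ^ 2 ≤ (2 * wt f) ^ 2 :=
        pow_le_pow_left₀ (wt_nonneg _) (wt_fdiff_le y f) 2
      gcongr
    refine le_trans (le_of_eq ?_) (Finset.sum_le_sum fun y _ => h1 y)
    rw [← Finset.mul_sum, Finset.sum_sub_distrib, ← Finset.mul_sum, sum_wt_fdiff]
    simp only [Finset.sum_const, Finset.card_univ, nsmul_eq_mul, ← hNdef]
    have h4 : (4 : ℝ) ^ m = 2 ^ m * 2 ^ m := by rw [← mul_pow]; norm_num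
    field_simp
    rw [pow_succ, pow_succ, pow_succ, h4]
    ring

/-- A nonzero function of degree at most `d` is nonzero on at least a `2⁻ᵈ` fraction of points. -/
lemma card_le_of_degLT {d : ℕ} {f : V → ZMod 2} (hf : DegLT (d + 1) f) (hne : ∃ x, f x ≠ 0) :
    (Fintype.card V : ℝ) ≤ 2 ^ d * wt f := by
  induction d generalizing f with
  | zero =>
    obtain ⟨x, hx⟩ := hne
    have : ∀ z, f z ≠ 0 := by
      intro z hz
      have := hf (x - z) z
      simp [fdiff, hz, hx] at this
    simp [wt, ind, this]
  | succ d ih =>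
    by_cases h : ∃ y x, fdiff y f x ≠ 0
    · obtain ⟨y, hy⟩ := h
      refine (ih (hf y) hy).trans ?_
      rw [pow_succ, mul_assoc]
      gcongr
      exact wt_fdiff_le y f
    · push Not at h
      have h1 : DegLT 1 f := fun y x => h y x
      have h2 := ih (h1.mono (by omega)) hne
      have := wt_nonneg f
      have h3 : (0 : ℝ) < 2 ^ d := by positivity
      rw [pow_succ]
      nlinarith [mul_nonneg h3.le this]

end Counting

section SmallCodimension

variable {V : Type} [AddCommGroup V]

/-- The directions in which the derivative of `f` has degree `< m`. -/
def lowDir (m : ℕ) (f : V → ZMod 2) : AddSubgroup V where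
  carrier := {y | DegLT m (fdiff y f)}
  zero_mem' := by
    simp only [Set.mem_ofPred_eq, fdiff_zero_dir]
    exact DegLT.zero m
  add_mem' := by
    intro y z hy hz
    simp only [Set.mem_ofPred_eq, fdiff_add_dir] at *
    exact (hz.translate y).add hy
  neg_mem' := by
    intro y hy
    have h : fdiff (-y) f = fun x => fdiff y f (x + -y) := by
      funext x
      simp [fdiff, add_comm]
    simp only [Set.mem_ofPred_eq, h]
    exact DegLT.translate hy (-y)

lemma mem_lowDir {m : ℕ} {f : V → ZMod 2} {y : V} : y ∈ lowDir m f ↔ DegLT m (fdiff y f) :=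
  Iff.rfl

lemma two_mul_card_le_of_lt [Finite V] {H K : AddSubgroup V} (h : H < K) :
    2 * Nat.card H ≤ Nat.card K := by
  obtain ⟨k, hk⟩ := AddSubgroup.card_dvd_of_le h.le
  have hpos : 0 < Nat.card K := Nat.card_pos
  have h1 : k ≠ 1 := by
    rintro rfl
    exact h.ne (AddSubgroup.eq_of_le_of_card_ge h.le (by omega))
  have h0 : k ≠ 0 := by rintro rfl; omega
  have : 2 ≤ k := by omega
  rw [hk, mul_comm]
  exact Nat.mul_le_mul_left _ this

variable [Module (ZMod 2) V]

lemma card_lowDir_le [Finite V] {m : ℕ} {f : V → ZMod 2} (hf : ¬ DegLT (m + 1) f) :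
    Nat.card (lowDir m f) * 2 ^ (m + 1) ≤ Nat.card V := by
  induction m generalizing f with
  | zero =>
    have h : lowDir 0 f < ⊤ := by
      rw [lt_top_iff_ne_top]
      intro h
      exact hf fun y => mem_lowDir.1 (h ▸ AddSubgroup.mem_top y)
    have := two_mul_card_le_of_lt h
    rw [AddSubgroup.card_top] at this
    omega
  | succ m ih =>
    obtain ⟨z, hz⟩ := not_forall.1 hf
    have hlt : lowDir (m + 1) f < lowDir m (fdiff z f) := by
      refine lt_of_le_of_ne (fun y hy => ?_) fun h => hz ?_
      · rw [mem_lowDir, fdiff_comm]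
        exact mem_lowDir.1 hy z
      · rw [← mem_lowDir, h, mem_lowDir]
        have : fdiff z (fdiff z f) = 0 := by
          funext x
          simp only [fdiff, add_assoc, ZModModule.add_self, add_zero, Pi.zero_apply]
          linear_combination CharTwo.add_self_eq_zero (f (x + z)) + CharTwo.add_self_eq_zero (f x)
        rw [this]
        exact DegLT.zero m
    have h1 := two_mul_card_le_of_lt hlt
    have h2 := ih hz
    calc _ = 2 * Nat.card (lowDir (m + 1) f) * 2 ^ (m + 1) := by ring
      _ ≤ _ := (Nat.mul_le_mul_right _ h1).trans h2

lemma degLT_of_card_lt [Finite V] {m : ℕ} (h : Nat.card V < 2 ^ (m + 1)) (f : V → ZMod 2) :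
    DegLT (m + 1) f := by
  by_contra hf
  have h1 := card_lowDir_le hf
  have h2 : 0 < Nat.card (lowDir m f) := Nat.card_pos
  have := Nat.mul_le_mul_right (2 ^ (m + 1)) h2
  omega

/-- A lower bound for the probability that `m` successive random derivatives do not annihilate a
function of degree at least `m`. -/
def survival (m : ℕ) : ℝ := ∏ i ∈ Finset.range m, (1 - (1 / 2) ^ (i + 1))

lemma survival_succ (m : ℕ) : survival (m + 1) = survival m * (1 - (1 / 2) ^ (m + 1)) :=
  Finset.prod_range_succ _ m

lemma quarter_le_survival_succ (m : ℕ) : 1 / 4 + (1 / 2) ^ (m + 2) ≤ survival (m + 1) := by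
  induction m with
  | zero => norm_num [survival]
  | succ m ih =>
    rw [survival_succ]
    have h1 : (1 / 2 : ℝ) ^ (m + 2) ≤ 1 / 4 := by
      calc (1 / 2 : ℝ) ^ (m + 2) = (1 / 2) ^ m * (1 / 4) := by ring
        _ ≤ 1 * (1 / 4) := by gcongr; exact pow_le_one₀ (by norm_num) (by norm_num)
        _ = 1 / 4 := one_mul _
    have h0 : (0 : ℝ) < (1 / 2) ^ (m + 2) := by positivity
    have h2 : (1 / 2 : ℝ) ^ (m + 1 + 2) = (1 / 2) ^ (m + 2) / 2 := by ring
    have h3 : (1 / 2 : ℝ) ^ (m + 1 + 1) = (1 / 2) ^ (m + 2) := by ring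
    rw [h2, h3]
    nlinarith

lemma survival_nonneg (m : ℕ) : 0 ≤ survival m :=
  Finset.prod_nonneg fun i _ => sub_nonneg.2 (pow_le_one₀ (by norm_num) (by norm_num))

/-- In small codimension a function that is not of degree `< m` is rejected with probability
bounded below. -/
lemma survival_mul_le_rejCount [Fintype V] {m r : ℕ} {f : V → ZMod 2} (hf : DegLT (m + r + 1) f)
    (hm : ¬ DegLT m f) :
    survival m * (Fintype.card V : ℝ) ^ (m + 1) ≤ 2 ^ r * rejCount m f := by
  induction m generalizing f with
  | zero =>
    rw [zero_add] at hf
    have hne : ∃ x, f x ≠ 0 := not_forall.1 hm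
    simpa [survival, rejCount] using card_le_of_degLT hf hne
  | succ m ih =>
    set N : ℝ := (Fintype.card V : ℝ) with hN
    have hNpos : 0 < N := card_pos_real V
    set G : Finset V := Finset.univ.filter fun y => ¬ DegLT m (fdiff y f) with hG
    have hcard : (Finset.univ.filter fun y => DegLT m (fdiff y f)).card
        = Nat.card (lowDir m f) := by
      rw [Nat.card_eq_fintype_card, Fintype.card_subtype]
      rfl
    have hGc : N * (1 - (1 / 2) ^ (m + 1)) ≤ G.card := by
      have h1 := card_lowDir_le hm
      rw [← hcard, Nat.card_eq_fintype_card] at h1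
      have h2 := Finset.card_filter_add_card_filter_not (s := (Finset.univ : Finset V))
        (fun y => DegLT m (fdiff y f))
      rw [Finset.card_univ] at h2
      have h1' : ((Finset.univ.filter fun y => DegLT m (fdiff y f)).card : ℝ) * 2 ^ (m + 1) ≤ N := by
        rw [hN]; exact_mod_cast h1
      have h2' : ((Finset.univ.filter fun y => DegLT m (fdiff y f)).card : ℝ) + G.card = N := by
        rw [hN]; exact_mod_cast h2
      have h3 : ((Finset.univ.filter fun y => DegLT m (fdiff y f)).card : ℝ)
          ≤ N * (1 / 2) ^ (m + 1) := by
        rw [one_div, inv_pow, ← div_eq_mul_inv, le_div_iff₀ (by positivity)]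
        exact h1'
      linarith
    calc survival (m + 1) * N ^ (m + 1 + 1)
        = (N * (1 - (1 / 2) ^ (m + 1))) * (survival m * N ^ (m + 1)) := by
          rw [survival_succ]; ring
      _ ≤ G.card * (survival m * N ^ (m + 1)) := by
          have := survival_nonneg m
          gcongr
      _ = ∑ y ∈ G, survival m * N ^ (m + 1) := by rw [Finset.sum_const, nsmul_eq_mul]
      _ ≤ ∑ y ∈ G, 2 ^ r * rejCount m (fdiff y f) := by
          refine Finset.sum_le_sum fun y hy => ih ?_ (Finset.mem_filter.1 hy).2
          have : m + 1 + r + 1 = (m + r + 1) + 1 := by ring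
          rw [this] at hf
          exact hf y
      _ ≤ ∑ y, 2 ^ r * rejCount m (fdiff y f) :=
          Finset.sum_le_sum_of_subset_of_nonneg (Finset.subset_univ _) fun y _ _ =>
            mul_nonneg (by positivity) (rejCount_nonneg _ _)
      _ = 2 ^ r * rejCount (m + 1) f := by rw [← Finset.mul_sum]; rfl

end SmallCodimension

section Hyperplanes

variable {V : Type} [AddCommGroup V] [Module (ZMod 2) V]

lemma two_mul_card_filter_apply_eq_zero {L : Finset (V →ₗ[ZMod 2] ZMod 2)}
    (hL : ∀ a ∈ L, ∀ b ∈ L, a + b ∈ L) {y : V} {l₀ : V →ₗ[ZMod 2] ZMod 2} (h₀ : l₀ ∈ L)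
    (hy : l₀ y = 1) : 2 * (L.filter fun l => l y = 0).card = L.card := by
  have h1 : (L.filter fun l => l y = 0).card = (L.filter fun l => ¬ l y = 0).card := by
    refine Finset.card_bij' (fun l _ => l + l₀) (fun l _ => l + l₀) ?_ ?_ ?_ ?_
    · intro l hl
      rw [Finset.mem_filter] at hl ⊢
      exact ⟨hL _ hl.1 _ h₀, by simp [hl.2, hy]⟩
    · intro l hl
      rw [Finset.mem_filter] at hl ⊢
      have := (zmod_two_cases (l y)).resolve_left hl.2
      exact ⟨hL _ hl.1 _ h₀, by simp [this, hy, CharTwo.add_self_eq_zero]⟩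
    · intro l _; simp [add_assoc, ZModModule.add_self]
    · intro l _; simp [add_assoc, ZModModule.add_self]
  have h2 := Finset.card_filter_add_card_filter_not (s := L) (fun l => l y = 0)
  omega

variable [Fintype V]

instance : Fintype (V →ₗ[ZMod 2] ZMod 2) :=
  haveI : Finite (V →ₗ[ZMod 2] ZMod 2) := DFunLike.finite _
  Fintype.ofFinite _

/-- Like `rejCount`, but only counting derivative directions in the kernel of `l`. -/
def kerCount (l : V →ₗ[ZMod 2] ZMod 2) : ℕ → (V → ZMod 2) → ℝ
  | 0, f => wt f
  | m + 1, f => ∑ y, if l y = 0 then kerCount l m (fdiff y f) else 0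

lemma kerCount_zero_form (m : ℕ) (f : V → ZMod 2) :
    kerCount (0 : V →ₗ[ZMod 2] ZMod 2) m f = rejCount m f := by
  induction m generalizing f with
  | zero => rfl
  | succ m ih => simp [kerCount, rejCount, ih]

lemma kerCount_zero_fun (l : V →ₗ[ZMod 2] ZMod 2) (m : ℕ) : kerCount l m 0 = 0 := by
  induction m with
  | zero => simp [kerCount, wt, ind_zero]
  | succ m ih =>
    refine Finset.sum_eq_zero fun y _ => ?_
    have : fdiff y (0 : V → ZMod 2) = 0 := by funext x; simp [fdiff]
    rw [this, ih, ite_self]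

/-- Double counting pairs of a flat and a hyperplane direction containing it. -/
lemma sum_kerCount {L : Finset (V →ₗ[ZMod 2] ZMod 2)} (hL : ∀ a ∈ L, ∀ b ∈ L, a + b ∈ L)
    (m : ℕ) {f : V → ZMod 2} (hf : ∀ z, (∀ l ∈ L, l z = 0) → ∀ x, f (x + z) = f x) :
    2 ^ m * ∑ l ∈ L, kerCount l m f = L.card * rejCount m f := by
  induction m generalizing L f with
  | zero => simp [kerCount, rejCount]
  | succ m ih =>
    simp only [kerCount]
    rw [Finset.sum_comm, rejCount, Finset.mul_sum, Finset.mul_sum]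
    refine Finset.sum_congr rfl fun y _ => ?_
    by_cases hy : ∀ l ∈ L, l y = 0
    · have : fdiff y f = 0 := by
        funext x
        simp [fdiff, hf y hy x, CharTwo.add_self_eq_zero]
      simp [this, kerCount_zero_fun, rejCount_zero_fun]
    · push Not at hy
      obtain ⟨l₀, h₀, hy⟩ := hy
      replace hy := (zmod_two_cases (l₀ y)).resolve_left hy
      rw [← Finset.sum_filter, ← two_mul_card_filter_apply_eq_zero hL h₀ hy]
      have h := ih (L := L.filter fun l => l y = 0) (f := fdiff y f) ?_ ?_
      · push_cast
        rw [pow_succ]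
        linear_combination 2 * h
      · intro a ha b hb
        rw [Finset.mem_filter] at ha hb ⊢
        exact ⟨hL _ ha.1 _ hb.1, by simp [ha.2, hb.2]⟩
      · intro z hz x
        have hz' : ∀ l ∈ L, l z = l y * l₀ z := by
          intro l hl
          rcases zmod_two_cases (l y) with h | h
          · rw [h, zero_mul]
            exact hz l (Finset.mem_filter.2 ⟨hl, h⟩)
          · have := hz (l + l₀) (Finset.mem_filter.2
              ⟨hL _ hl _ h₀, by simp [h, hy, CharTwo.add_self_eq_zero]⟩)
            rw [h, one_mul]
            exact CharTwo.add_eq_zero.1 this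
        rcases zmod_two_cases (l₀ z) with h0 | h0
        · have hinv := hf z fun l hl => by rw [hz' l hl, h0, mul_zero]
          simp only [fdiff, add_right_comm x z y, hinv]
        · have hinv := hf (z + y) fun l hl => by
            rw [map_add, hz' l hl, h0, mul_one, CharTwo.add_self_eq_zero]
          have h1 : f (x + z + y) = f x := by rw [add_assoc, hinv]
          have h2 : f (x + z) = f (x + y) := by
            rw [← hinv (x + y), add_assoc x y, add_comm z y, ← add_assoc y, ZModModule.add_self,
              zero_add]
          simp only [fdiff, h1, h2]
          ring

/-- Splitting `V` along the two sides of a nonzero linear form. -/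
def splitEquiv (l : V →ₗ[ZMod 2] ZMod 2) (v : V) (hv : l v = 1) :
    LinearMap.ker l × ZMod 2 ≃ V where
  toFun p := p.1 + p.2 • v
  invFun x := (⟨x - l x • v, by simp [hv]⟩, l x)
  left_inv p := by
    have h := LinearMap.mem_ker.1 p.1.2
    ext <;> simp [h, hv]
  right_inv x := by simp

lemma kerCount_eq (l : V →ₗ[ZMod 2] ZMod 2) (v : V) (hv : l v = 1) (m : ℕ) (f : V → ZMod 2) :
    kerCount l m f = ∑ a : ZMod 2, rejCount m (fun u : LinearMap.ker l => f (u + a • v)) := by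
  induction m generalizing f with
  | zero =>
    simp only [kerCount, rejCount, wt]
    rw [← Fintype.sum_equiv (splitEquiv l v hv) (fun p => ind (f (p.1 + p.2 • v))) _ fun _ => rfl,
      Fintype.sum_prod_type, Finset.sum_comm]
  | succ m ih =>
    simp only [kerCount, rejCount]
    rw [← Finset.sum_filter, Finset.sum_comm]
    rw [Finset.sum_subtype (p := fun y => y ∈ LinearMap.ker l) _ (by simp)]
    refine Finset.sum_congr rfl fun u _ => ?_
    rw [ih]
    refine Finset.sum_congr rfl fun a _ => ?_
    congr 1
    funext x
    simp [fdiff, add_right_comm]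

lemma two_mul_card_ker (l : V →ₗ[ZMod 2] ZMod 2) (v : V) (hv : l v = 1) :
    2 * Fintype.card (LinearMap.ker l) = Fintype.card V := by
  rw [← Fintype.card_congr (splitEquiv l v hv), Fintype.card_prod, ZMod.card, mul_comm]

lemma exists_apply_eq_one {l : V →ₗ[ZMod 2] ZMod 2} (hl : l ≠ 0) : ∃ v, l v = 1 := by
  by_contra! h
  exact hl (LinearMap.ext fun v => (zmod_two_cases (l v)).resolve_right (h v))

lemma card_dual : Fintype.card (V →ₗ[ZMod 2] ZMod 2) = Fintype.card V := by
  rw [← Nat.card_eq_fintype_card, ← Nat.card_eq_fintype_card]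
  rw [Module.natCard_eq_pow_finrank (K := ZMod 2) (V := V),
    Module.natCard_eq_pow_finrank (K := ZMod 2) (V := V →ₗ[ZMod 2] ZMod 2)]
  rw [Subspace.dual_finrank_eq]

end Hyperplanes

section Gluing

variable {V : Type} [AddCommGroup V] [Module (ZMod 2) V]

/-- The indicator of the hyperplane `{x | i.1 x = i.2}`, as an affine function. -/
def side (i : (V →ₗ[ZMod 2] ZMod 2) × ZMod 2) (x : V) : ZMod 2 := i.1 x + i.2 + 1

lemma side_eq_one_iff {i : (V →ₗ[ZMod 2] ZMod 2) × ZMod 2} {x : V} : side i x = 1 ↔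
    i.1 x = i.2 := by
  simp [side, CharTwo.add_eq_zero]

lemma side_add (i : (V →ₗ[ZMod 2] ZMod 2) × ZMod 2) (x y : V) :
    side i (x + y) = side i x + i.1 y := by
  simp only [side, map_add]
  ring

lemma DegLT.side_mul {m : ℕ} {f : V → ZMod 2} (hf : DegLT m f)
    (i : (V →ₗ[ZMod 2] ZMod 2) × ZMod 2) : DegLT (m + 1) (fun x => side i x * f x) :=
  hf.affine_mul (side i) i.1 (side_add i)

variable [Fintype V]

/-- Two low-degree functions close to `f` on two hyperplanes agree on the intersection. -/
lemma eq_on_inter_of_close {d : ℕ} {f P Q : V → ZMod 2} {i j : (V →ₗ[ZMod 2] ZMod 2) × ZMod 2}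
    (hP : DegLT (d + 1) P) (hQ : DegLT (d + 1) Q)
    (hi : 2 ^ d * wt (fun x => side i x * (f x + P x)) ≤ Fintype.card V / 48)
    (hj : 2 ^ d * wt (fun x => side j x * (f x + Q x)) ≤ Fintype.card V / 48)
    {x : V} (hxi : side i x = 1) (hxj : side j x = 1) : P x = Q x := by
  by_contra hne
  have hdeg : DegLT (d + 2 + 1) (fun x => side i x * (side j x * (P + Q) x)) :=
    ((hP.add hQ).side_mul j).side_mul i
  have h1 := card_le_of_degLT hdeg ⟨x, by
    simpa [hxi, hxj, CharTwo.add_eq_zero] using hne⟩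
  have h2 : wt (fun x => side i x * (side j x * (P + Q) x))
      ≤ wt (fun x => side i x * (f x + P x)) + wt (fun x => side j x * (f x + Q x)) := by
    unfold wt
    rw [← Finset.sum_add_distrib]
    refine Finset.sum_le_sum fun x _ => ?_
    simp only [Pi.add_apply]
    generalize f x = a
    generalize P x = b
    generalize Q x = c
    rcases zmod_two_cases (side i x) with h | h <;> rcases zmod_two_cases (side j x) with h' | h' <;>
      rcases zmod_two_cases a with rfl | rfl <;> rcases zmod_two_cases b with rfl | rfl <;>
      rcases zmod_two_cases c with rfl | rfl <;>
      simp [h, h', ind, CharTwo.add_self_eq_zero]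
  have hN := card_pos_real V
  have h3 : (2 : ℝ) ^ (d + 2) = 4 * 2 ^ d := by ring
  have h4 := mul_le_mul_of_nonneg_left h2 (by positivity : (0 : ℝ) ≤ 2 ^ d)
  rw [h3] at h1
  linarith

/-- Low-degree functions agreeing on pairwise intersections of many hyperplanes glue together along
`s` independent ones. -/
lemma exists_glue {d : ℕ} {G : Finset ((V →ₗ[ZMod 2] ZMod 2) × ZMod 2)}
    {P : (V →ₗ[ZMod 2] ZMod 2) × ZMod 2 → V → ZMod 2} (hP : ∀ i ∈ G, DegLT (d + 1) (P i))
    (hag : ∀ i ∈ G, ∀ j ∈ G, ∀ x, side i x = 1 → side j x = 1 → P i x = P j x) (s : ℕ)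
    (hs : 2 ^ s < G.card) :
    ∃ S ⊆ G, ∃ Q, DegLT (d + 1) Q ∧ (∀ j ∈ S, ∀ x, side j x = 1 → Q x = P j x) ∧
      2 ^ s * (Finset.univ.filter fun x => ∀ j ∈ S, side j x = 0).card ≤ Fintype.card V ∧
      (Finset.univ.filter fun l : V →ₗ[ZMod 2] ZMod 2 =>
        ∀ x, (∀ j ∈ S, j.1 x = 0) → l x = 0).card ≤ 2 ^ s := by
  induction s with
  | zero =>
    refine ⟨∅, by simp, 0, DegLT.zero _, by simp, ?_, ?_⟩
    · simp
    · rw [pow_zero, Finset.card_le_one]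
      intro a ha b hb
      simp only [Finset.notMem_empty, false_implies, implies_true, true_implies,
        Finset.mem_filter, Finset.mem_univ, true_and] at ha hb
      ext x
      rw [ha, hb]
  | succ s ih =>
    obtain ⟨S, hSG, Q, hQ, hQP, hU, hL⟩ := ih (by rw [pow_succ] at hs; omega)
    set L := Finset.univ.filter fun l : V →ₗ[ZMod 2] ZMod 2 =>
        ∀ x, (∀ j ∈ S, j.1 x = 0) → l x = 0 with hLdef
    obtain ⟨i, hiG, hiL⟩ : ∃ i ∈ G, i.1 ∉ L := by
      by_contra! h
      have hsub : G ⊆ L ×ˢ Finset.univ := fun i hi =>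
        Finset.mem_product.2 ⟨h i hi, Finset.mem_univ _⟩
      have := Finset.card_le_card hsub
      rw [Finset.card_product, Finset.card_univ, ZMod.card] at this
      rw [pow_succ] at hs
      omega
    obtain ⟨v, hv, hiv⟩ : ∃ v, (∀ j ∈ S, j.1 v = 0) ∧ i.1 v = 1 := by
      simp only [hLdef, Finset.mem_filter, Finset.mem_univ, true_and, not_forall] at hiL
      obtain ⟨v, hv, h⟩ := hiL
      exact ⟨v, hv, (zmod_two_cases _).resolve_left h⟩
    have hsv : ∀ j ∈ S, ∀ x, side j (x + v) = side j x := fun j hj x => by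
      rw [side_add, hv j hj, add_zero]
    set π : V → V := fun x => x + (side i x + 1) • v with hπ
    have hπi : ∀ x, side i (π x) = 1 := fun x => by
      simp only [hπ, side_add, map_smul, hiv, smul_eq_mul, mul_one]
      rw [← add_assoc, CharTwo.add_self_eq_zero, zero_add]
    have hπj : ∀ j ∈ S, ∀ x, side j (π x) = side j x := fun j hj x => by
      simp only [hπ, side_add, map_smul, hv j hj, smul_zero, add_zero]
    refine ⟨insert i S, Finset.insert_subset hiG hSG, Q + (Q + P i) ∘ π,
      hQ.add ((hQ.add (hP i hiG)).comp_affine π (fun y => y + i.1 y • v) fun x y => ?_), ?_, ?_, ?_⟩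
    · simp only [hπ, side_add, add_smul, one_smul]
      abel
    · intro j hj x hx
      simp only [Pi.add_apply, Function.comp_apply]
      rcases Finset.mem_insert.1 hj with rfl | hj
      · have : π x = x := by simp [hπ, hx, CharTwo.add_self_eq_zero]
        rw [this, ← add_assoc, CharTwo.add_self_eq_zero, zero_add]
      · have h1 : side j (π x) = 1 := by rw [hπj j hj, hx]
        rw [hQP j hj _ h1, hag i hiG j (hSG hj) _ (hπi x) h1, CharTwo.add_self_eq_zero, add_zero]
        exact hQP j hj x hx
    · refine le_trans ?_ hU
      rw [pow_succ, mul_assoc]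
      refine Nat.mul_le_mul_left _ ?_
      set U' := Finset.univ.filter fun x => ∀ j ∈ insert i S, side j x = 0 with hU'
      have hdisj : Disjoint U' (U'.map (Equiv.addRight v).toEmbedding) := by
        rw [Finset.disjoint_left]
        intro x hx hx'
        simp only [Finset.mem_map, hU', Finset.mem_filter, Finset.mem_univ, true_and,
          Equiv.coe_toEmbedding, Equiv.coe_addRight] at hx hx'
        obtain ⟨z, hz, rfl⟩ := hx'
        have h1 := hx i (Finset.mem_insert_self _ _)
        rw [side_add, hz i (Finset.mem_insert_self _ _), hiv] at h1
        simp at h1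
      have hsub : U' ∪ U'.map (Equiv.addRight v).toEmbedding
          ⊆ Finset.univ.filter fun x => ∀ j ∈ S, side j x = 0 := by
        intro x hx
        rw [Finset.mem_filter]
        refine ⟨Finset.mem_univ _, fun j hj => ?_⟩
        rcases Finset.mem_union.1 hx with hx | hx
        · exact (Finset.mem_filter.1 hx).2 j (Finset.mem_insert_of_mem hj)
        · obtain ⟨z, hz, rfl⟩ := Finset.mem_map.1 hx
          rw [Equiv.coe_toEmbedding, Equiv.coe_addRight, hsv j hj]
          exact (Finset.mem_filter.1 hz).2 j (Finset.mem_insert_of_mem hj)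
      have := Finset.card_le_card hsub
      rwa [Finset.card_union_of_disjoint hdisj, Finset.card_map, ← two_mul] at this
    · rw [pow_succ]
      refine le_trans ?_ (Nat.mul_le_mul_right 2 hL)
      have h2 : (Finset.univ : Finset (ZMod 2)).card = 2 := by rw [Finset.card_univ, ZMod.card]
      refine le_of_le_of_eq (b := (L ×ˢ (Finset.univ : Finset (ZMod 2))).card) ?_
        (by rw [Finset.card_product, h2])
      refine Finset.card_le_card_of_injOn (fun l => (l + l v • i.1, l v)) ?_ ?_
      · intro l hl
        simp only [Finset.coe_filter, Finset.mem_univ, true_and, Set.mem_ofPred_eq] at hl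
        simp only [Finset.coe_product, Set.mem_prod, hLdef, Finset.coe_filter, Finset.mem_univ,
          true_and, Set.mem_ofPred_eq, Finset.coe_univ, Set.mem_univ, and_true]
        intro x hx
        have h1 := hl (x + i.1 x • v) fun j hj => by
          rcases Finset.mem_insert.1 hj with rfl | hj
          · simp [hiv, CharTwo.add_self_eq_zero]
          · simp [hx j hj, hv j hj]
        simpa [mul_comm] using h1
      · intro a _ b _ hab
        simp only [Prod.mk.injEq] at hab
        have h := hab.1
        rw [hab.2] at h
        exact add_right_cancel h

/-- The glued function agrees with all the local ones. -/
lemma exists_common {d : ℕ} {G : Finset ((V →ₗ[ZMod 2] ZMod 2) × ZMod 2)}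
    {P : (V →ₗ[ZMod 2] ZMod 2) × ZMod 2 → V → ZMod 2} (hP : ∀ i ∈ G, DegLT (d + 1) (P i))
    (hag : ∀ i ∈ G, ∀ j ∈ G, ∀ x, side i x = 1 → side j x = 1 → P i x = P j x)
    (hG : 2 ^ (d + 2) < G.card) :
    ∃ Q, DegLT (d + 1) Q ∧ ∀ i ∈ G, ∀ x, side i x = 1 → Q x = P i x := by
  obtain ⟨S, hSG, Q, hQ, hQP, hU, -⟩ := exists_glue hP hag (d + 2) hG
  refine ⟨Q, hQ, fun i hi x hx => ?_⟩
  by_contra hne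
  have h1 := card_le_of_degLT ((hQ.add (hP i hi)).side_mul i)
    ⟨x, by simpa [hx, CharTwo.add_eq_zero] using hne⟩
  rw [wt_eq_card] at h1
  have h2 : (Finset.univ.filter fun x => side i x * (Q + P i) x ≠ 0).card
      ≤ (Finset.univ.filter fun x => ∀ j ∈ S, side j x = 0).card := by
    refine Finset.card_le_card fun z hz => ?_
    rw [Finset.mem_filter] at hz ⊢
    refine ⟨Finset.mem_univ _, fun j hj => (zmod_two_cases _).resolve_right fun hj1 => hz.2 ?_⟩
    rcases zmod_two_cases (side i z) with h | h
    · rw [h, zero_mul]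
    · rw [Pi.add_apply, hQP j hj z hj1, hag i hi j (hSG hj) z h hj1, CharTwo.add_self_eq_zero,
        mul_zero]
  have h3 : Fintype.card V
      ≤ 2 ^ (d + 1) * (Finset.univ.filter fun x => side i x * (Q + P i) x ≠ 0).card := by
    exact_mod_cast h1
  have h4 := Nat.mul_le_mul_left (2 ^ (d + 1)) h2
  have h5 : 0 < Fintype.card V := Fintype.card_pos
  have h6 : 2 ^ (d + 2) = 2 ^ (d + 1) * 2 := pow_succ _ _
  rw [h6, mul_assoc, mul_left_comm] at hU
  omega

/-- Hyperplanes with distinct directions are pairwise independent. -/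
lemma sum_sq_side_le (G : Finset ((V →ₗ[ZMod 2] ZMod 2) × ZMod 2)) :
    ∑ x : V, (∑ i ∈ G, (ind (side i x) - 1 / 2)) ^ 2 ≤ G.card * (Fintype.card V : ℝ) / 2 := by
  have hb : ∀ (i j : (V →ₗ[ZMod 2] ZMod 2) × ZMod 2) (x : V),
      (ind (side i x) - 1 / 2) * (ind (side j x) - 1 / 2) ≤ 1 / 4 := by
    intro i j x
    rcases zmod_two_cases (side i x) with h | h <;> rcases zmod_two_cases (side j x) with h' | h' <;>
      rw [h, h'] <;> norm_num [ind]
  have horth : ∀ i j : (V →ₗ[ZMod 2] ZMod 2) × ZMod 2, i.1 ≠ j.1 →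
      ∑ x : V, (ind (side i x) - 1 / 2) * (ind (side j x) - 1 / 2) = 0 := by
    intro i j hij
    obtain ⟨v, hv⟩ := exists_apply_eq_one (sub_ne_zero.2 hij)
    have h1 := sum_comp_add_right v
      (fun x => (ind (side i x) - 1 / 2) * (ind (side j x) - 1 / 2))
    have h2 : ∀ x, (ind (side i (x + v)) - 1 / 2) * (ind (side j (x + v)) - 1 / 2)
        = -((ind (side i x) - 1 / 2) * (ind (side j x) - 1 / 2)) := by
      intro x
      rw [LinearMap.sub_apply] at hv
      rw [side_add, side_add, ind_add, ind_add]
      generalize i.1 v = a at hv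
      generalize j.1 v = b at hv
      rcases zmod_two_cases a with rfl | rfl <;> rcases zmod_two_cases b with rfl | rfl <;>
        simp [ind_zero, ind_one] at hv ⊢ <;> ring
    simp only [h2, Finset.sum_neg_distrib] at h1
    linarith
  have hsum : ∀ i ∈ G, ∑ j ∈ G, ∑ x : V, (ind (side i x) - 1 / 2) * (ind (side j x) - 1 / 2)
      ≤ (Fintype.card V : ℝ) / 2 := by
    intro i hi
    rw [← Finset.sum_filter_add_sum_filter_not G (fun j => j.1 = i.1)]
    rw [Finset.sum_eq_zero (s := G.filter fun j => ¬ j.1 = i.1)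
      (fun j hj => horth i j (Ne.symm (Finset.mem_filter.1 hj).2)), add_zero]
    have hc : (G.filter fun j => j.1 = i.1).card ≤ 2 := by
      have hsub : (G.filter fun j => j.1 = i.1) ⊆ {i.1} ×ˢ (Finset.univ : Finset (ZMod 2)) := by
        intro j hj
        exact Finset.mem_product.2
          ⟨Finset.mem_singleton.2 (Finset.mem_filter.1 hj).2, Finset.mem_univ _⟩
      simpa [ZMod.card] using Finset.card_le_card hsub
    have hc' : ((G.filter fun j => j.1 = i.1).card : ℝ) ≤ 2 := by exact_mod_cast hc
    have hN := card_pos_real V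
    calc _ ≤ ∑ j ∈ G.filter (fun j => j.1 = i.1), ∑ x : V, (1 / 4 : ℝ) := by
          exact Finset.sum_le_sum fun j _ => Finset.sum_le_sum fun x _ => hb i j x
      _ = (G.filter fun j => j.1 = i.1).card * (Fintype.card V * (1 / 4) : ℝ) := by
          simp
      _ ≤ 2 * (Fintype.card V * (1 / 4) : ℝ) := by gcongr
      _ = _ := by ring
  calc ∑ x : V, (∑ i ∈ G, (ind (side i x) - 1 / 2)) ^ 2
      = ∑ i ∈ G, ∑ j ∈ G, ∑ x : V, (ind (side i x) - 1 / 2) * (ind (side j x) - 1 / 2) := by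
        simp only [pow_two, Finset.sum_mul_sum]
        rw [Finset.sum_comm]
        exact Finset.sum_congr rfl fun i _ => Finset.sum_comm
    _ ≤ ∑ i ∈ G, (Fintype.card V : ℝ) / 2 := Finset.sum_le_sum hsum
    _ = _ := by rw [Finset.sum_const, nsmul_eq_mul]; ring

/-- If `f` is close to low-degree functions on many hyperplanes, it is close to a low-degree
function. -/
lemma exists_close_of_many {d : ℕ} {f : V → ZMod 2}
    {G : Finset ((V →ₗ[ZMod 2] ZMod 2) × ZMod 2)} (hG : 36 * 2 ^ d < G.card)
    (hclose : ∀ i ∈ G, ∃ P, DegLT (d + 1) P ∧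
      2 ^ d * wt (fun x => side i x * (f x + P x)) ≤ Fintype.card V / 48) :
    ∃ Q, DegLT (d + 1) Q ∧ 2 ^ d * wt (f + Q) ≤ Fintype.card V / 8 := by
  choose! P hP hPf using hclose
  obtain ⟨Q, hQ, hQP⟩ := exists_common hP
    (fun i hi j hj x hxi hxj => eq_on_inter_of_close (hP i hi) (hP j hj) (hPf i hi) (hPf j hj) hxi hxj)
    (by rw [pow_add]; omega)
  refine ⟨Q, hQ, ?_⟩
  set N : ℝ := (Fintype.card V : ℝ) with hNdef
  set g : ℝ := (G.card : ℝ) with hg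
  have hN : 0 < N := card_pos_real V
  have hgd : 36 * 2 ^ d < g := by rw [hg]; exact_mod_cast hG
  have h2d : (0 : ℝ) < 2 ^ d := by positivity
  have hg0 : 0 < g := by linarith
  have hpt : ∀ x, g ^ 2 * ind ((f + Q) x) ≤ 3 * g * ∑ i ∈ G, ind (side i x * (f x + P i x))
      + 9 / 2 * (∑ i ∈ G, (ind (side i x) - 1 / 2)) ^ 2 := by
    intro x
    rcases zmod_two_cases ((f + Q) x) with h | h
    · rw [h, ind_zero, mul_zero]
      have := Finset.sum_nonneg fun i (_ : i ∈ G) => ind_nonneg (side i x * (f x + P i x))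
      positivity
    · have h1 : ∑ i ∈ G, ind (side i x * (f x + P i x)) = ∑ i ∈ G, ind (side i x) := by
        refine Finset.sum_congr rfl fun i hi => ?_
        rcases zmod_two_cases (side i x) with hs | hs
        · rw [hs, zero_mul]
        · rw [← hQP i hi x hs, ← Pi.add_apply f Q, h, mul_one]
      rw [h1, h, ind_one, Finset.sum_sub_distrib, Finset.sum_const, nsmul_eq_mul]
      nlinarith [sq_nonneg (∑ i ∈ G, ind (side i x) - g / 6)]
  have hsum : g ^ 2 * wt (f + Q) ≤ 3 * g * ∑ i ∈ G, wt (fun x => side i x * (f x + P i x))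
      + 9 / 2 * (g * N / 2) := by
    calc g ^ 2 * wt (f + Q) = ∑ x, g ^ 2 * ind ((f + Q) x) := by rw [wt, Finset.mul_sum]
      _ ≤ _ := Finset.sum_le_sum fun x _ => hpt x
      _ = 3 * g * ∑ i ∈ G, wt (fun x => side i x * (f x + P i x))
          + 9 / 2 * ∑ x, (∑ i ∈ G, (ind (side i x) - 1 / 2)) ^ 2 := by
        rw [Finset.sum_add_distrib, ← Finset.mul_sum, ← Finset.mul_sum, Finset.sum_comm]
        rfl
      _ ≤ _ := by
        have := sum_sq_side_le G
        gcongr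
  have hclose : 2 ^ d * ∑ i ∈ G, wt (fun x => side i x * (f x + P i x)) ≤ g * (N / 48) := by
    rw [Finset.mul_sum, hg, ← nsmul_eq_mul]
    exact Finset.sum_le_card_nsmul _ _ _ hPf
  have h1 : g ^ 2 * (2 ^ d * wt (f + Q)) ≤ g ^ 2 * (N / 8) := by
    have h2 := mul_le_mul_of_nonneg_left hsum h2d.le
    have h3 := mul_le_mul_of_nonneg_left hclose (by positivity : 0 ≤ 3 * g)
    have h4 := mul_le_mul_of_nonneg_left hgd.le (by positivity : 0 ≤ g * N / 16)
    nlinarith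
  exact le_of_mul_le_mul_left h1 (by positivity)

end Gluing

section Induction

/-- `f` is far from every function of degree at most `d`. -/
def Far {V : Type} [AddCommGroup V] [Fintype V] (d : ℕ) (f : V → ZMod 2) : Prop :=
  ∀ P, DegLT (d + 1) P → (Fintype.card V : ℝ) / 24 < 2 ^ d * wt (f + P)

lemma le_rejCount_of_close {V : Type} [AddCommGroup V] [Fintype V] {d : ℕ} {f P : V → ZMod 2}
    (hP : DegLT (d + 1) P) (h : 2 ^ d * wt (f + P) ≤ (Fintype.card V : ℝ) / 4) :
    (Fintype.card V : ℝ) ^ (d + 1) * (2 ^ d * wt (f + P)) ≤ rejCount (d + 1) f := by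
  rw [← rejCount_add f hP]
  refine le_trans ?_ (le_rejCount_of_wt (d + 1) (f + P))
  have hN := card_pos_real V
  have hw := wt_nonneg (f + P)
  set N : ℝ := (Fintype.card V : ℝ)
  set w := wt (f + P)
  have hD : (0 : ℝ) < 2 ^ d := by positivity
  have h4 : (4 : ℝ) ^ (d + 1) = 4 * (2 ^ d * 2 ^ d) := by rw [pow_succ, ← mul_pow]; norm_num; ring
  refine mul_le_mul_of_nonneg_left ?_ (by positivity)
  have h5 : (4 ^ (d + 1) - 2 ^ (d + 1)) * w ^ 2 / N ≤ 2 ^ d * w := by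
    rw [div_le_iff₀ hN, h4, pow_succ]
    nlinarith [mul_nonneg hD.le hw, mul_nonneg hD.le (sq_nonneg w)]
  have h6 : (2 : ℝ) ^ (d + 1) * w = 2 * (2 ^ d * w) := by rw [pow_succ]; ring
  linarith

variable {V : Type} [AddCommGroup V] [Module (ZMod 2) V] [Fintype V]

lemma Far.le_rejCount_of_card_lt {d : ℕ} {f : V → ZMod 2} (hf : Far d f)
    (hV : Fintype.card V < 2 ^ (d + 10)) :
    (Fintype.card V : ℝ) ^ (d + 2) / 1024 ≤ rejCount (d + 1) f := by
  have hN := card_pos_real V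
  have hdeg : ¬ DegLT (d + 1) f := by
    intro h
    have h1 := hf f h
    have h2 : f + f = 0 := by funext x; simp [CharTwo.add_self_eq_zero]
    rw [h2] at h1
    simp only [wt, Pi.zero_apply, ind_zero, Finset.sum_const_zero, mul_zero] at h1
    linarith
  have h1 := survival_mul_le_rejCount (m := d + 1) (r := 8)
    (degLT_of_card_lt (by rwa [Nat.card_eq_fintype_card]) f) hdeg
  have h2 := quarter_le_survival_succ d
  have h3 : (0 : ℝ) < (1 / 2) ^ (d + 2) := by positivity
  have h4 : (0 : ℝ) < (Fintype.card V : ℝ) ^ (d + 1 + 1) := by positivity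
  rw [show d + 2 = d + 1 + 1 from rfl]
  nlinarith

lemma sum_kerCount_ne_zero (m : ℕ) (f : V → ZMod 2) :
    2 ^ m * ∑ l ∈ Finset.univ.filter (fun l : V →ₗ[ZMod 2] ZMod 2 => l ≠ 0), kerCount l m f
      = (Fintype.card V - 2 ^ m) * rejCount m f := by
  have h1 := sum_kerCount (L := (Finset.univ : Finset (V →ₗ[ZMod 2] ZMod 2))) (by simp) m (f := f)
    fun z hz x => by
      have : z = 0 := (Module.forall_dual_apply_eq_zero_iff (ZMod 2) z).1
        fun l => hz l (Finset.mem_univ _)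
      rw [this, add_zero]
  rw [Finset.card_univ, card_dual] at h1
  rw [← Finset.sum_erase_add _ _ (Finset.mem_univ (0 : V →ₗ[ZMod 2] ZMod 2)),
    kerCount_zero_form] at h1
  have h2 : Finset.univ.filter (fun l : V →ₗ[ZMod 2] ZMod 2 => l ≠ 0) = Finset.univ.erase 0 := by
    ext l; simp
  rw [h2]
  linear_combination h1

/-- A low-degree approximation on one side of a hyperplane extends to the whole space. -/
lemma exists_extension {d : ℕ} {f : V → ZMod 2} {l : V →ₗ[ZMod 2] ZMod 2} {v : V} (hv : l v = 1)
    (a : ZMod 2) {g : LinearMap.ker l → ZMod 2} (hg : DegLT (d + 1) g) :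
    ∃ P, DegLT (d + 1) P ∧ wt (fun x => side (l, a) x * (f x + P x))
      = wt ((fun u : LinearMap.ker l => f (u + a • v)) + g) := by
  set π : V → LinearMap.ker l := fun x => ((splitEquiv l v hv).symm x).1 with hπ
  have hadd : ∀ x y, π (x + y) = π x + π y := by
    intro x y
    ext
    simp only [hπ, splitEquiv, Equiv.coe_fn_symm_mk, map_add, add_smul, Submodule.coe_add]
    abel
  refine ⟨g ∘ π, hg.comp_affine π π hadd, ?_⟩
  unfold wt
  rw [← Fintype.sum_equiv (splitEquiv l v hv)
    (fun p => ind (side (l, a) (p.1 + p.2 • v) * (f (p.1 + p.2 • v) + g p.1))) _ ?_,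
    Fintype.sum_prod_type, Finset.sum_comm, Finset.sum_eq_single a]
  · refine Finset.sum_congr rfl fun u _ => ?_
    have hu : l u = 0 := LinearMap.mem_ker.1 u.2
    have : side (l, a) (u + a • v) = 1 := side_eq_one_iff.2 (by simp [hu, hv])
    rw [this, one_mul]
    rfl
  · intro b _ hb
    refine Finset.sum_eq_zero fun u _ => ?_
    have hu : l u = 0 := LinearMap.mem_ker.1 u.2
    have : side (l, a) (u + b • v) = 0 := (zmod_two_cases _).resolve_right fun h =>
      hb (by simpa [hu, hv] using side_eq_one_iff.1 h)
    rw [this, zero_mul, ind_zero]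
  · simp
  · intro p
    have h1 : splitEquiv l v hv p = p.1 + p.2 • v := rfl
    have h2 : π (splitEquiv l v hv p) = p.1 := by simp [hπ]
    rw [← h1]
    simp only [Function.comp_apply, h2]

/-- If `f` is far from low degree on all but few hyperplanes, the rejection count on `V` inherits
the bound valid on hyperplanes. -/
lemma sum_restrict_le {d : ℕ} {f : V → ZMod 2} {c g : ℝ} (hc : 0 ≤ c)
    (hg : ((Finset.univ.filter fun i : (V →ₗ[ZMod 2] ZMod 2) × ZMod 2 =>
      ∃ P, DegLT (d + 1) P ∧
        2 ^ d * wt (fun x => side i x * (f x + P x)) ≤ Fintype.card V / 48).card : ℝ) ≤ g)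
    (ih : ∀ (l : V →ₗ[ZMod 2] ZMod 2) (h : LinearMap.ker l → ZMod 2), l ≠ 0 → Far d h →
      c ≤ rejCount (d + 1) h) :
    2 ^ (d + 1) * ((2 * (Fintype.card V - 1) - g) * c)
      ≤ (Fintype.card V - 2 ^ (d + 1)) * rejCount (d + 1) f := by
  rw [← sum_kerCount_ne_zero]
  refine mul_le_mul_of_nonneg_left ?_ (by positivity)
  set G := Finset.univ.filter fun i : (V →ₗ[ZMod 2] ZMod 2) × ZMod 2 =>
      ∃ P, DegLT (d + 1) P ∧ 2 ^ d * wt (fun x => side i x * (f x + P x)) ≤ Fintype.card V / 48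
    with hG
  set Λ := Finset.univ.filter (fun l : V →ₗ[ZMod 2] ZMod 2 => l ≠ 0) with hΛ
  have hex : ∀ l : V →ₗ[ZMod 2] ZMod 2, l ≠ 0 → ∃ v, l v = 1 := fun l => exists_apply_eq_one
  choose! v hv using hex
  have hcard : (2 * (Fintype.card V - 1) : ℝ)
      ≤ G.card + ((Λ ×ˢ (Finset.univ : Finset (ZMod 2))) \ G).card := by
    have h1 := Finset.card_sdiff_add_card (Λ ×ˢ (Finset.univ : Finset (ZMod 2))) G
    have h2 := Finset.card_le_card
      (Finset.subset_union_left (s₁ := Λ ×ˢ (Finset.univ : Finset (ZMod 2))) (s₂ := G))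
    have h3 : (Λ ×ˢ (Finset.univ : Finset (ZMod 2))).card = Λ.card * 2 := by
      rw [Finset.card_product, Finset.card_univ, ZMod.card]
    have h4 : Λ.card + 1 = Fintype.card V := by
      have : Λ = Finset.univ.erase 0 := by ext l; simp [hΛ]
      rw [this, Finset.card_erase_add_one (Finset.mem_univ _), Finset.card_univ, card_dual]
    have h5 : 2 * Fintype.card V
        ≤ G.card + ((Λ ×ˢ (Finset.univ : Finset (ZMod 2))) \ G).card + 2 := by omega
    have h6 : (2 * Fintype.card V : ℝ)
        ≤ G.card + ((Λ ×ˢ (Finset.univ : Finset (ZMod 2))) \ G).card + 2 := by exact_mod_cast h5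
    linarith
  calc (2 * (Fintype.card V - 1) - g) * c
      ≤ ((Λ ×ˢ (Finset.univ : Finset (ZMod 2))) \ G).card * c := by
        gcongr
        linarith
    _ = ∑ i ∈ (Λ ×ˢ (Finset.univ : Finset (ZMod 2))) \ G, c := by
        rw [Finset.sum_const, nsmul_eq_mul]
    _ ≤ ∑ i ∈ (Λ ×ˢ (Finset.univ : Finset (ZMod 2))) \ G,
          rejCount (d + 1) (fun u : LinearMap.ker i.1 => f (u + i.2 • v i.1)) := by
        refine Finset.sum_le_sum fun i hi => ?_
        rw [Finset.mem_sdiff, Finset.mem_product] at hi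
        have hl : i.1 ≠ 0 := (Finset.mem_filter.1 hi.1.1).2
        refine ih i.1 _ hl fun P hP => ?_
        by_contra! hle
        obtain ⟨Q, hQ, hQw⟩ := exists_extension (f := f) (hv i.1 hl) i.2 hP
        refine hi.2 (Finset.mem_filter.2 ⟨Finset.mem_univ _, Q, hQ, ?_⟩)
        rw [hQw]
        refine hle.trans (le_of_eq ?_)
        rw [← two_mul_card_ker i.1 _ (hv i.1 hl)]
        push_cast
        ring
    _ ≤ ∑ i ∈ Λ ×ˢ (Finset.univ : Finset (ZMod 2)),
          rejCount (d + 1) (fun u : LinearMap.ker i.1 => f (u + i.2 • v i.1)) :=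
        Finset.sum_le_sum_of_subset_of_nonneg Finset.sdiff_subset
          fun _ _ _ => rejCount_nonneg _ _
    _ = ∑ l ∈ Λ, kerCount l (d + 1) f := by
        rw [Finset.sum_product]
        exact Finset.sum_congr rfl fun l hl =>
          (kerCount_eq l _ (hv l (Finset.mem_filter.1 hl).2) _ _).symm

lemma Far.le_rejCount_of_le_card {d n : ℕ} (hn : d + 9 ≤ n) :
    ∀ (V : Type) [AddCommGroup V] [Module (ZMod 2) V] [Fintype V] (f : V → ZMod 2),
      Fintype.card V = 2 ^ n → Far d f →
      1 / 2 ^ 18 * (1 + 72 * 2 ^ d / Fintype.card V) * (Fintype.card V : ℝ) ^ (d + 2)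
        ≤ rejCount (d + 1) f := by
  induction n, hn using Nat.le_induction with
  | base =>
    intro V _ _ _ f hV hf
    refine le_trans ?_ (hf.le_rejCount_of_card_lt (by rw [hV]; gcongr <;> norm_num))
    have hD : (0 : ℝ) < 2 ^ d := by positivity
    have h : (72 * 2 ^ d / (Fintype.card V : ℝ)) ≤ 1 := by
      rw [hV]
      push_cast
      rw [pow_add, div_le_one (by positivity)]
      linarith
    have hN := card_pos_real V
    have hp : 0 < (Fintype.card V : ℝ) ^ (d + 2) := by positivity
    nlinarith
  | succ n hn ih =>
    intro V _ _ _ f hV hf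
    have hN := card_pos_real V
    have hD : (1 : ℝ) ≤ 2 ^ d := one_le_pow₀ (by norm_num)
    have hND : 1024 * 2 ^ d ≤ (Fintype.card V : ℝ) := by
      rw [hV]
      push_cast
      calc (1024 * 2 ^ d : ℝ) = 2 ^ (d + 10) := by rw [pow_add]; ring
        _ ≤ 2 ^ (n + 1) := pow_le_pow_right₀ (by norm_num) (by omega)
    set G := Finset.univ.filter fun i : (V →ₗ[ZMod 2] ZMod 2) × ZMod 2 =>
      ∃ P, DegLT (d + 1) P ∧ 2 ^ d * wt (fun x => side i x * (f x + P x)) ≤ Fintype.card V / 48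
      with hG
    by_cases hcase : 36 * 2 ^ d < G.card
    · obtain ⟨Q, hQ, hQw⟩ := exists_close_of_many hcase fun i hi => (Finset.mem_filter.1 hi).2
      refine le_trans ?_ (le_rejCount_of_close hQ (by linarith))
      have h1 := hf Q hQ
      have h2 : 72 * 2 ^ d / (Fintype.card V : ℝ) ≤ 1 := by
        rw [div_le_one hN]
        linarith
      have h3 : (Fintype.card V : ℝ) ^ (d + 2)
          = (Fintype.card V : ℝ) ^ (d + 1) * Fintype.card V := pow_succ _ _
      rw [h3, mul_comm, mul_assoc]
      refine mul_le_mul_of_nonneg_left ?_ (by positivity)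
      nlinarith
    · set N : ℝ := (Fintype.card V : ℝ) with hNdef
      set D : ℝ := 2 ^ d with hDdef
      set c : ℝ := 1 / 2 ^ 18 * (1 + 72 * D / (N / 2)) * (N / 2) ^ (d + 2) with hcdef
      have hgD : (G.card : ℝ) ≤ 36 * D := by
        rw [hDdef]
        exact_mod_cast not_lt.1 hcase
      have key := sum_restrict_le (f := f) (c := c) (by positivity) hgD fun l h hl hfar => by
        obtain ⟨v, hv⟩ := exists_apply_eq_one hl
        have hk := two_mul_card_ker l v hv
        have hk' : (Fintype.card (LinearMap.ker l) : ℝ) = N / 2 := by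
          rw [hNdef, ← hk]
          push_cast
          ring
        have := ih (LinearMap.ker l) h (by rw [hV, pow_succ] at hk; omega) hfar
        rwa [hk'] at this
      rw [← hNdef] at key
      have h2 : (2 : ℝ) ^ (d + 1) * c
          = 1 / 2 ^ 18 * (1 + 72 * D / (N / 2)) * N ^ (d + 2) / 2 := by
        rw [hcdef, div_pow, pow_succ 2 (d + 1)]
        field_simp
      have h3 : (2 : ℝ) ^ (d + 1) = 2 * D := by rw [pow_succ, hDdef]; ring
      rw [mul_left_comm, h2, h3] at key
      have hpos : 0 < N - 2 * D := by linarith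
      refine le_of_mul_le_mul_left (le_trans ?_ key) hpos
      have hp : 0 < N ^ (d + 2) := by positivity
      have hmain : (N - 2 * D) * (1 + 72 * D / N)
          ≤ (N - 1 - 18 * D) * (1 + 72 * D / (N / 2)) := by
        have e1 : (N - 2 * D) * (1 + 72 * D / N) = (N - 2 * D) * (N + 72 * D) / N := by
          field_simp
        have e2 : (N - 1 - 18 * D) * (1 + 72 * D / (N / 2))
            = (N - 1 - 18 * D) * (N + 144 * D) / N := by
          field_simp
          ring
        rw [e1, e2]
        gcongr ?_ / _
        nlinarith
      calc (N - 2 * D) * (1 / 2 ^ 18 * (1 + 72 * D / N) * N ^ (d + 2))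
          = (N - 2 * D) * (1 + 72 * D / N) * (1 / 2 ^ 18 * N ^ (d + 2)) := by ring
        _ ≤ (N - 1 - 18 * D) * (1 + 72 * D / (N / 2)) * (1 / 2 ^ 18 * N ^ (d + 2)) := by gcongr
        _ = _ := by ring

/-- Functions far from low degree are rejected with probability bounded below. -/
lemma Far.le_rejCount {d n : ℕ} {f : V → ZMod 2} (hV : Fintype.card V = 2 ^ n) (hf : Far d f) :
    1 / 2 ^ 18 * (Fintype.card V : ℝ) ^ (d + 2) ≤ rejCount (d + 1) f := by
  have hN := card_pos_real V
  have hp : 0 < (Fintype.card V : ℝ) ^ (d + 2) := by positivity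
  by_cases hn : d + 9 ≤ n
  · refine le_trans ?_ (Far.le_rejCount_of_le_card hn V f hV hf)
    gcongr
    have : 0 ≤ 72 * 2 ^ d / (Fintype.card V : ℝ) := by positivity
    linarith
  · have h := hf.le_rejCount_of_card_lt (by
      rw [hV]
      exact Nat.pow_lt_pow_right (by norm_num) (by omega))
    linarith

end Induction

section Polynomial

lemma degLE_of_degLT {n d : ℕ} {g : (Fin n → ZMod 2) → ZMod 2} (hg : DegLT (d + 1) g) :
    degLE n d g := by
  induction n generalizing d with
  | zero =>
    refine ⟨MvPolynomial.C (g 0), by simp, fun x => ?_⟩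
    rw [MvPolynomial.eval_C, Subsingleton.elim x 0]
  | succ n ih =>
    have hcons : ∀ x y : Fin n → ZMod 2,
        (Fin.cons 0 (x + y) : Fin (n + 1) → ZMod 2) = Fin.cons 0 x + Fin.cons 0 y := by
      intro x y
      ext i
      refine Fin.cases ?_ (fun j => ?_) i <;> simp
    obtain ⟨p, hp, hpe⟩ := ih (hg.comp_affine (fun x : Fin n → ZMod 2 => Fin.cons 0 x) _ hcons)
    obtain ⟨q, hq, hqe⟩ : ∃ q : MvPolynomial (Fin n) (ZMod 2),
        (MvPolynomial.X 0 * MvPolynomial.rename Fin.succ q).totalDegree ≤ d ∧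
        ∀ x, MvPolynomial.eval x q = fdiff (Pi.single 0 1) g (Fin.cons 0 x) := by
      have h := (hg (Pi.single 0 1)).comp_affine
        (fun x : Fin n → ZMod 2 => (Fin.cons 0 x : Fin (n + 1) → ZMod 2)) _ hcons
      cases d with
      | zero => exact ⟨0, by simp, fun x => by rw [map_zero]; exact (h x).symm⟩
      | succ d =>
        obtain ⟨q, hq, hqe⟩ := ih h
        refine ⟨q, (MvPolynomial.totalDegree_mul _ _).trans ?_, hqe⟩
        have h1 := MvPolynomial.totalDegree_rename_le (Fin.succ : Fin n → Fin (n + 1)) q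
        rw [MvPolynomial.totalDegree_X]
        omega
    refine ⟨MvPolynomial.rename Fin.succ p + MvPolynomial.X 0 * MvPolynomial.rename Fin.succ q,
      (MvPolynomial.totalDegree_add _ _).trans
        (max_le ((MvPolynomial.totalDegree_rename_le _ _).trans hp) hq), fun x => ?_⟩
    rw [map_add, map_mul, MvPolynomial.eval_X, MvPolynomial.eval_rename,
      MvPolynomial.eval_rename, hpe, hqe]
    have hx : ∀ a : ZMod 2, x 0 = a → x = Fin.cons a (x ∘ Fin.succ) := by
      rintro a rfl
      ext i
      refine Fin.cases ?_ (fun j => ?_) i <;> simp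
    rcases zmod_two_cases (x 0) with h | h
    · rw [h, zero_mul, add_zero, Function.comp_apply, ← hx 0 h]
    · have h1 : (Fin.cons 0 (x ∘ Fin.succ) + Pi.single 0 1 : Fin (n + 1) → ZMod 2) = x := by
        rw [hx 1 h]
        ext i
        refine Fin.cases ?_ (fun j => ?_) i <;> simp
      rw [h, one_mul, fdiff, h1, Function.comp_apply]
      linear_combination CharTwo.add_self_eq_zero (g (Fin.cons 0 (x ∘ Fin.succ)))

lemma degLT_const {V : Type} [AddCommGroup V] (c : ZMod 2) : DegLT 1 (fun _ : V => c) :=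
  fun _ _ => CharTwo.add_self_eq_zero c

lemma DegLT.sum {V ι : Type} [AddCommGroup V] {m : ℕ} (s : Finset ι) (f : ι → V → ZMod 2)
    (hf : ∀ i ∈ s, DegLT m (f i)) : DegLT m (fun x => ∑ i ∈ s, f i x) := by
  induction s using Finset.induction_on with
  | empty =>
    simp only [Finset.sum_empty]
    exact DegLT.zero m
  | insert a s ha ih =>
    simp only [Finset.sum_insert ha]
    exact (hf a (Finset.mem_insert_self _ _)).add
      (ih fun i hi => hf i (Finset.mem_insert_of_mem hi))

lemma DegLT.pow_mul {n m : ℕ} {f : (Fin n → ZMod 2) → ZMod 2} (hf : DegLT m f) (i : Fin n)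
    (k : ℕ) : DegLT (m + k) (fun x => x i ^ k * f x) := by
  induction k with
  | zero => simpa using hf
  | succ k ih =>
    have := ih.affine_mul (fun x => x i) (fun x => x i) fun x y => rfl
    simp only [pow_succ', mul_assoc]
    exact this

lemma degLT_of_degLE {n d : ℕ} {g : (Fin n → ZMod 2) → ZMod 2} (hg : degLE n d g) :
    DegLT (d + 1) g := by
  obtain ⟨p, hp, hpe⟩ := hg
  obtain rfl : g = fun x => ∑ s ∈ p.support, p.coeff s * ∏ i, x i ^ s i := by
    funext x
    rw [← hpe, MvPolynomial.eval_eq']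
  refine DegLT.sum _ _ fun s hs => ?_
  have key : ∀ t : Finset (Fin n),
      DegLT (1 + ∑ i ∈ t, s i) (fun x : Fin n → ZMod 2 => (∏ i ∈ t, x i ^ s i) * p.coeff s) := by
    intro t
    induction t using Finset.induction_on with
    | empty => simpa using degLT_const (p.coeff s)
    | insert a t ha ih =>
      simp only [Finset.prod_insert ha, Finset.sum_insert ha, mul_assoc]
      rw [add_comm (s a), ← add_assoc]
      exact ih.pow_mul a (s a)
  simp only [mul_comm (p.coeff s)]
  refine (key Finset.univ).mono ?_
  have h1 := MvPolynomial.le_totalDegree hs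
  rw [Finsupp.sum_fintype _ _ fun _ => rfl] at h1
  omega

/-- A function of degree below the dimension sums to zero. -/
lemma sum_eq_zero_of_degLE {k d : ℕ} (hd : d < k) {g : (Fin k → ZMod 2) → ZMod 2}
    (hg : degLE k d g) : ∑ u, g u = 0 := by
  obtain ⟨p, hp, hpe⟩ := hg
  simp only [← hpe]
  refine MvPolynomial.sum_eval_eq_zero p ?_
  rw [ZMod.card, Fintype.card_fin]
  omega

end Polynomial

section Test

/-- The sum of `f` over the cube at `x` spanned by `y`. -/
def cubeSum {V : Type} [AddCommGroup V] [Module (ZMod 2) V] {k : ℕ} (f : V → ZMod 2)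
    (y : Fin k → V) (x : V) : ZMod 2 :=
  ∑ c : Fin k → ZMod 2, f (x + ∑ i, c i • y i)

variable {V : Type} [AddCommGroup V] [Module (ZMod 2) V]

lemma cubeSum_cons {k : ℕ} (f : V → ZMod 2) (y : V) (z : Fin k → V) (x : V) :
    cubeSum f (Fin.cons y z) x = cubeSum (fdiff y f) z x := by
  unfold cubeSum
  rw [← (Fin.consEquiv fun _ : Fin (k + 1) => ZMod 2).sum_comp, Fintype.sum_prod_type,
    Finset.sum_comm]
  refine Finset.sum_congr rfl fun c _ => ?_
  have h : ∀ F : ZMod 2 → ZMod 2, ∑ a, F a = F 0 + F 1 := fun F => Fin.sum_univ_two F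
  rw [h]
  simp only [Fin.consEquiv_apply, Fin.sum_univ_succ, Fin.cons_zero, Fin.cons_succ, zero_smul,
    one_smul, zero_add, fdiff]
  rw [add_comm, add_comm y, add_assoc]

lemma rejCount_eq_sum [Fintype V] (k : ℕ) (f : V → ZMod 2) :
    rejCount k f = ∑ y : Fin k → V, wt (cubeSum f y) := by
  induction k generalizing f with
  | zero =>
    rw [Fintype.sum_unique]
    have : cubeSum f (default : Fin 0 → V) = f := by
      funext x
      simp [cubeSum]
    rw [this]
    rfl
  | succ k ih =>
    rw [← (Fin.consEquiv fun _ : Fin (k + 1) => V).sum_comp, Fintype.sum_prod_type]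
    refine Finset.sum_congr rfl fun y _ => ?_
    rw [ih]
    refine Finset.sum_congr rfl fun z _ => ?_
    congr 1
    funext x
    exact (cubeSum_cons f y z x).symm

variable {n k : ℕ}

lemma mulVec_injective_of_sum_ne_zero {M : Matrix (Fin n) (Fin k) (ZMod 2)} {b : Fin n → ZMod 2}
    {f : (Fin n → ZMod 2) → ZMod 2} (h : ∑ u, f (M.mulVec u + b) ≠ 0) :
    Function.Injective M.mulVec := by
  by_contra hinj
  apply h
  obtain ⟨u, v, huv, hne⟩ : ∃ u v, M.mulVec u = M.mulVec v ∧ u ≠ v := by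
    simpa [Function.Injective] using hinj
  have hw : M.mulVec (u + v) = 0 := by
    rw [Matrix.mulVec_add, huv]
    ext i
    exact CharTwo.add_self_eq_zero _
  have hw0 : u + v ≠ 0 := fun h0 => hne (by
    ext i
    exact CharTwo.add_eq_zero.1 (congrFun h0 i))
  refine Finset.sum_involution (fun c _ => c + (u + v)) (fun c _ => ?_) (fun c _ _ => ?_)
    (fun _ _ => Finset.mem_univ _) fun c _ => ?_
  · rw [Matrix.mulVec_add, hw, add_zero]
    exact CharTwo.add_self_eq_zero _
  · simpa using hw0
  · rw [add_assoc]
    ext i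
    simp [CharTwo.add_self_eq_zero]

lemma rejCount_le_card (d : ℕ) (hd : d < k) (f : (Fin n → ZMod 2) → ZMod 2) :
    rejCount k f ≤
      ((Finset.univ.filter fun Mb : Matrix (Fin n) (Fin k) (ZMod 2) × (Fin n → ZMod 2) =>
        Function.Injective Mb.1.mulVec ∧
          ¬ degLE k d (fun u => f (Mb.1.mulVec u + Mb.2))).card : ℝ) := by
  have hcube : ∀ (M : Matrix (Fin n) (Fin k) (ZMod 2)) b,
      cubeSum f M.transpose b = ∑ u, f (M.mulVec u + b) := by
    intro M b
    refine Finset.sum_congr rfl fun u _ => ?_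
    rw [add_comm, Matrix.mulVec_eq_sum]
    simp
  rw [rejCount_eq_sum, Finset.card_filter, Fintype.sum_prod_type]
  push_cast
  rw [← (Equiv.sum_comp (⟨Matrix.transpose, Matrix.transpose, fun _ => rfl, fun _ => rfl⟩ :
    Matrix (Fin n) (Fin k) (ZMod 2) ≃ (Fin k → Fin n → ZMod 2)) _)]
  refine Finset.sum_le_sum fun M _ => Finset.sum_le_sum fun b _ => ?_
  change ind (cubeSum f M.transpose b) ≤ _
  rw [hcube, ind]
  split_ifs with h1 h2 h2
  · exact zero_le_one
  · exact le_rfl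
  · exact le_rfl
  · exact absurd ⟨mulVec_injective_of_sum_ne_zero h1, fun h3 => h1 (sum_eq_zero_of_degLE hd h3)⟩ h2

lemma rejCount_div_le_Rej (d : ℕ) (f : (Fin n → ZMod 2) → ZMod 2) :
    rejCount (d + 1) f / (Fintype.card (Fin n → ZMod 2) : ℝ) ^ (d + 2) ≤ Rej n d (d + 1) f := by
  have h1 := rejCount_le_card d (Nat.lt_succ_self d) f
  have h2 := rejCount_nonneg (d + 1) f
  unfold Rej
  set A := Finset.univ.filter fun Mb : Matrix (Fin n) (Fin (d + 1)) (ZMod 2) × (Fin n → ZMod 2) =>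
    Function.Injective Mb.1.mulVec ∧ ¬ degLE (d + 1) d (fun u => f (Mb.1.mulVec u + Mb.2))
  set B := Finset.univ.filter fun Mb : Matrix (Fin n) (Fin (d + 1)) (ZMod 2) × (Fin n → ZMod 2) =>
    Function.Injective Mb.1.mulVec
  have hAB : A.card ≤ B.card :=
    Finset.card_le_card (Finset.monotone_filter_right _ fun _ _ h => h.1)
  have hB : (B.card : ℝ) ≤ (Fintype.card (Fin n → ZMod 2) : ℝ) ^ (d + 2) := by
    have h3 : B.card ≤ Fintype.card (Fin n → ZMod 2) ^ (d + 2) := by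
      refine (Finset.card_le_univ B).trans (le_of_eq ?_)
      rw [Fintype.card_prod, Fintype.card_congr (⟨Matrix.transpose, Matrix.transpose, fun _ => rfl,
        fun _ => rfl⟩ : Matrix (Fin n) (Fin (d + 1)) (ZMod 2) ≃ (Fin (d + 1) → Fin n → ZMod 2)),
        Fintype.card_fun (α := Fin (d + 1)), Fintype.card_fin, ← pow_succ]
    exact_mod_cast h3
  rcases Nat.eq_zero_or_pos B.card with h0 | h0
  · have hA : A.card = 0 := by omega
    have : rejCount (d + 1) f = 0 := le_antisymm (by simpa [hA] using h1) h2
    rw [this, zero_div]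
    positivity
  · have : (0 : ℝ) < B.card := by exact_mod_cast h0
    gcongr

lemma hdist_eq (f g : (Fin n → ZMod 2) → ZMod 2) : hdist n f g = wt (f + g) / 2 ^ n := by
  rw [hdist, wt_eq_card]
  congr 3
  ext x
  simp [CharTwo.add_eq_zero]

lemma exists_hdist_eq_deltaD (d : ℕ) (f : (Fin n → ZMod 2) → ZMod 2) :
    ∃ g, degLE n d g ∧ deltaD n d f = hdist n f g := by
  have hfin : {r : ℝ | ∃ g, degLE n d g ∧ r = hdist n f g}.Finite :=
    (Set.finite_range (hdist n f)).subset fun r ⟨g, _, hr⟩ => ⟨g, hr.symm⟩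
  have hne : {r : ℝ | ∃ g, degLE n d g ∧ r = hdist n f g}.Nonempty :=
    ⟨hdist n f 0, 0, ⟨0, by simp, fun x => by simp⟩, rfl⟩
  exact hne.csInf_mem hfin

lemma deltaD_le {d : ℕ} (f : (Fin n → ZMod 2) → ZMod 2) {g : (Fin n → ZMod 2) → ZMod 2}
    (hg : degLE n d g) : deltaD n d f ≤ hdist n f g :=
  csInf_le ⟨0, by rintro _ ⟨g, _, rfl⟩; unfold hdist; positivity⟩ ⟨g, hg, rfl⟩

end Test

end ReedMuller

theorem statement0 :
    ∃ ε₁ : ℝ, 0 < ε₁ ∧ ∀ (d n : ℕ), d + 1 ≤ n →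
      ∀ f : (Fin n → ZMod 2) → ZMod 2,
        min ((2:ℝ) ^ d * deltaD n d f) ε₁ ≤ Rej n d (d+1) f := by
  refine ⟨1 / 2 ^ 18, by norm_num, fun d n _ f => ?_⟩
  have hcard : Fintype.card (Fin n → ZMod 2) = 2 ^ n := by simp
  have hcardR : (Fintype.card (Fin n → ZMod 2) : ℝ) = 2 ^ n := by rw [hcard]; norm_num
  have hN : (0 : ℝ) < 2 ^ n := by positivity
  refine le_trans ?_ (ReedMuller.rejCount_div_le_Rej d f)
  rw [hcardR, le_div_iff₀ (by positivity)]
  obtain ⟨g, hg, hδ⟩ := ReedMuller.exists_hdist_eq_deltaD d f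
  by_cases h : 2 ^ d * deltaD n d f ≤ 1 / 4
  · have hw : 2 ^ d * ReedMuller.wt (f + g) = 2 ^ d * deltaD n d f * 2 ^ n := by
      rw [hδ, ReedMuller.hdist_eq]
      field_simp
    have key := ReedMuller.le_rejCount_of_close (f := f) (ReedMuller.degLT_of_degLE hg) (by
      rw [hw, hcardR]
      nlinarith)
    rw [hw, hcardR] at key
    refine le_trans ?_ key
    calc min (2 ^ d * deltaD n d f) (1 / 2 ^ 18) * (2 ^ n) ^ (d + 2)
        ≤ 2 ^ d * deltaD n d f * (2 ^ n) ^ (d + 2) := by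
          gcongr
          exact min_le_left _ _
      _ = _ := by ring
  · have hfar : ReedMuller.Far d f := by
      intro P hP
      have h1 := ReedMuller.deltaD_le f (ReedMuller.degLE_of_degLT hP)
      rw [ReedMuller.hdist_eq, le_div_iff₀ hN] at h1
      have h2 : (0 : ℝ) < 2 ^ d := by positivity
      rw [hcardR]
      nlinarith [mul_le_mul_of_nonneg_left h1 h2.le]
    have key := hfar.le_rejCount hcard
    rw [hcardR] at key
    refine le_trans ?_ key
    gcongr
    exact min_le_right _ _

end
end

section
/- There exist constants ε > 0, c₁ > 0 and c₂ > 0 such that for all integers d ≥ 0 and n ≥ d+1 and every f : F₂ⁿ → F₂: if ‖f‖_{U^{d+1}} ≥ 1 − ε/2^d, then c₁ · (1 − ‖f‖_{U^{d+1}}) ≤ δ_d(f) ≤ c₂ · (1 − ‖f‖_{U^{d+1}}). -/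
open scoped Classical

noncomputable section

namespace FlatTest

variable {V : Type} [AddCommGroup V] [Module (ZMod 2) V]

/-- The linear combination of the directions `a` with coefficients `u`. -/
def comb {m : ℕ} (a : Fin m → V) (u : Fin m → ZMod 2) : V := ∑ i, u i • a i

/-- The sum of `f` over the (parametrized) flat through `x` with directions `a`. -/
def flat {m : ℕ} (f : V → ZMod 2) (a : Fin m → V) (x : V) : ZMod 2 :=
  ∑ u : Fin m → ZMod 2, f (x + comb a u)

/-- The discrete derivative of `f` in direction `a`. -/
def der (a : V) (f : V → ZMod 2) : V → ZMod 2 := fun x => f (x + a) + f x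

/-- All sums of `f` over `m`-dimensional flats vanish, i.e. `f` has degree less than `m`. -/
def Poly (m : ℕ) (f : V → ZMod 2) : Prop := ∀ (a : Fin m → V) (x : V), flat f a x = 0

lemma comb_add {m : ℕ} (a : Fin m → V) (u v : Fin m → ZMod 2) :
    comb a (u + v) = comb a u + comb a v := by
  simp [comb, add_smul, Finset.sum_add_distrib]

lemma comb_succAbove {m : ℕ} (a : Fin (m + 1) → V) (u : Fin (m + 1) → ZMod 2) (i : Fin (m + 1)) :
    comb a u = u i • a i + comb (fun j => a (i.succAbove j)) (fun j => u (i.succAbove j)) :=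
  Fin.sum_univ_succAbove _ i

lemma zmod2_cases (c : ZMod 2) : c = 0 ∨ c = 1 := by
  fin_cases c
  exacts [Or.inl rfl, Or.inr rfl]

lemma zmod2_ne_zero {c : ZMod 2} : c ≠ 0 ↔ c = 1 := by
  rcases zmod2_cases c with rfl | rfl <;> simp

lemma zmod2_add_eq_zero {c e : ZMod 2} : c + e = 0 ↔ c = e := by
  rw [← ZModModule.sub_eq_add, sub_eq_zero]

lemma sum_zmod2 {M : Type*} [AddCommMonoid M] (F : ZMod 2 → M) : ∑ c, F c = F 0 + F 1 :=
  Fin.sum_univ_two F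

lemma flat_eq_flat_der {m : ℕ} (f : V → ZMod 2) (a : Fin (m + 1) → V) (x : V) (i : Fin (m + 1))
    (u : Fin (m + 1) → ZMod 2) (hu : u i = 1) :
    flat f a x = flat (der (comb a u) f) (fun j => a (i.succAbove j)) x := by
  have h1 : flat f a x = ∑ p : ZMod 2 × (Fin m → ZMod 2),
      f (x + (p.1 • a i + comb (fun j => a (i.succAbove j)) p.2)) := by
    symm
    refine Fintype.sum_equiv (Fin.insertNthEquiv (fun _ => ZMod 2) i) _ _ fun p => ?_
    rw [comb_succAbove a _ i]
    simp [Fin.insertNthEquiv]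
  rw [h1, Fintype.sum_prod_type, sum_zmod2, flat]
  simp only [der, Finset.sum_add_distrib, zero_smul, zero_add, one_smul]
  rw [add_comm]
  congr 1
  symm
  refine Fintype.sum_equiv (Equiv.addRight (fun j => u (i.succAbove j))) _ _ fun v => ?_
  rw [Equiv.coe_addRight, comb_add, comb_succAbove a u i, hu, one_smul]
  congr 1
  abel

lemma flat_succ {m : ℕ} (f : V → ZMod 2) (a : Fin (m + 1) → V) (x : V) :
    flat f a x = flat (der (a 0) f) (fun j => a j.succ) x := by
  rw [flat_eq_flat_der f a x 0 (Pi.single 0 1) (by simp)]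
  congr 2
  simp [comb, Pi.single_apply]

lemma flat_cons {m : ℕ} (f : V → ZMod 2) (b : V) (a : Fin m → V) (x : V) :
    flat f (Fin.cons b a : Fin (m + 1) → V) x = flat (der b f) a x := by
  rw [flat_succ]; simp

lemma flat_zero (f : V → ZMod 2) (a : Fin 0 → V) (x : V) : flat f a x = f x := by
  simp [flat, comb]

lemma flat_add {m : ℕ} (f g : V → ZMod 2) (a : Fin m → V) (x : V) :
    flat (f + g) a x = flat f a x + flat g a x := by
  simp [flat, Finset.sum_add_distrib]

lemma flat_zero_fun {m : ℕ} (a : Fin m → V) (x : V) : flat (0 : V → ZMod 2) a x = 0 := by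
  simp [flat]

lemma flat_comp {W : Type} [AddCommGroup W] [Module (ZMod 2) W] {m : ℕ} (f : W → ZMod 2)
    (φ : V →ₗ[ZMod 2] W) (c : W) (a : Fin m → V) (x : V) :
    flat (fun y => f (φ y + c)) a x = flat f (fun i => φ (a i)) (φ x + c) := by
  simp only [flat, comb, map_add, map_sum, map_smul]
  exact Finset.sum_congr rfl fun u _ => congrArg f (by abel)

lemma flat_add_comb {m : ℕ} (f : V → ZMod 2) (a : Fin m → V) (x : V) (u : Fin m → ZMod 2) :
    flat f a (x + comb a u) = flat f a x := by
  refine Fintype.sum_equiv (Equiv.addRight u) _ _ fun v => ?_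
  rw [Equiv.coe_addRight, comb_add]
  congr 1
  abel

lemma flat_der {m : ℕ} (f : V → ZMod 2) (b : V) (a : Fin m → V) (x : V) :
    flat (der b f) a x = flat f a (x + b) + flat f a x := by
  simp only [flat, der, Finset.sum_add_distrib]
  congr 1
  exact Finset.sum_congr rfl fun u _ => congrArg f (by abel)

namespace Poly

lemma zero_fun (m : ℕ) : Poly m (0 : V → ZMod 2) := fun a x => flat_zero_fun a x

lemma add {m : ℕ} {f g : V → ZMod 2} (hf : Poly m f) (hg : Poly m g) : Poly m (f + g) :=
  fun a x => by rw [flat_add, hf, hg, add_zero]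

lemma comp {W : Type} [AddCommGroup W] [Module (ZMod 2) W] {m : ℕ} {f : W → ZMod 2}
    (hf : Poly m f) (φ : V →ₗ[ZMod 2] W) (c : W) : Poly m (fun y => f (φ y + c)) :=
  fun a x => by rw [flat_comp, hf]

lemma shift {m : ℕ} {f : V → ZMod 2} (hf : Poly m f) (c : V) : Poly m (fun y => f (y + c)) :=
  hf.comp LinearMap.id c

end Poly

lemma poly_zero {f : V → ZMod 2} : Poly 0 f ↔ f = 0 := by
  simp only [Poly, flat_zero, forall_const, funext_iff, Pi.zero_apply]

lemma poly_succ {m : ℕ} {f : V → ZMod 2} : Poly (m + 1) f ↔ ∀ b, Poly m (der b f) := by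
  constructor
  · intro h b a x
    rw [← flat_cons, h]
  · intro h a x
    rw [flat_succ, h]

lemma flat_eq_zero_of_der {m : ℕ} {f : V → ZMod 2} {a : Fin (m + 1) → V}
    {u : Fin (m + 1) → ZMod 2} (hu : u ≠ 0) (h : Poly m (der (comb a u) f)) (x : V) :
    flat f a x = 0 := by
  obtain ⟨i, hi⟩ := Function.ne_iff.1 hu
  rw [flat_eq_flat_der f a x i u (zmod2_ne_zero.1 hi), h]

omit [Module (ZMod 2) V] in
lemma der_zero (f : V → ZMod 2) : der 0 f = 0 := by
  funext x; simp [der, ZModModule.add_self]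

lemma linearIndependent_of_flat_ne_zero {m : ℕ} {f : V → ZMod 2} {a : Fin m → V} {x : V}
    (h : flat f a x ≠ 0) : LinearIndependent (ZMod 2) a := by
  rw [Fintype.linearIndependent_iff]
  intro u hu i
  by_contra hi
  obtain ⟨k, rfl⟩ : ∃ k, m = k + 1 :=
    Nat.exists_eq_succ_of_ne_zero fun h0 => by subst h0; exact i.elim0
  refine h (flat_eq_zero_of_der (u := u) (fun h0 => hi (by simp [h0])) ?_ x)
  rw [show comb a u = 0 from hu, der_zero]
  exact Poly.zero_fun _

end FlatTest

namespace FlatTest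

variable {V : Type} [AddCommGroup V] [Module (ZMod 2) V]

/-- Schwartz–Zippel on an affine subspace `S`. -/
lemma card_le_card_ne_zero (S : Finset V) (hS : ∀ x ∈ S, ∀ y ∈ S, ∀ z ∈ S, x + y + z ∈ S)
    (d : ℕ) : ∀ g : V → ZMod 2, Poly (d + 1) g → (∃ x ∈ S, g x ≠ 0) →
      S.card ≤ 2 ^ d * (S.filter fun x => g x ≠ 0).card := by
  induction d with
  | zero =>
    rintro g hg ⟨x, hx, hgx⟩
    rw [Finset.filter_true_of_mem]
    · simp
    · intro y _ h0
      have := congrFun (poly_zero.1 (poly_succ.1 hg (y - x))) x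
      rw [der, add_sub_cancel, h0, zero_add] at this
      exact hgx this
  | succ d ih =>
    rintro g hg ⟨x, hx, hgx⟩
    by_cases hc : ∀ y ∈ S, g y ≠ 0
    · rw [Finset.filter_true_of_mem hc]
      exact Nat.le_mul_of_pos_left _ (by positivity)
    push Not at hc
    obtain ⟨y, hy, hgy⟩ := hc
    have htr : ∀ z ∈ S, z + (x + y) ∈ S := fun z hz => by
      rw [← add_assoc]; exact hS z hz x hx y hy
    have h1 := ih (der (x + y) g) (poly_succ.1 hg _) ⟨x, hx, by
      rw [der, ← add_assoc, ZModModule.add_self, zero_add, hgy, zero_add]; exact hgx⟩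
    have h2 : (S.filter fun z => der (x + y) g z ≠ 0).card ≤
        (S.filter fun z => g z ≠ 0).card + (S.filter fun z => g z ≠ 0).card := by
      calc _ ≤ ((S.filter fun z => g (z + (x + y)) ≠ 0) ∪ S.filter fun z => g z ≠ 0).card := by
            refine Finset.card_le_card fun z hz => ?_
            rw [Finset.mem_filter, der] at hz
            simp only [Finset.mem_filter, Finset.mem_union]
            by_contra hcon
            push Not at hcon
            exact hz.2 (by rw [hcon.1 hz.1, hcon.2 hz.1, add_zero])
        _ ≤ _ := (Finset.card_union_le _ _).trans (Nat.add_le_add_right ?_ _)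
      refine Finset.card_le_card_of_injOn (fun z => z + (x + y)) (fun z hz => ?_)
        (fun _ _ _ _ h => add_right_cancel h)
      simp only [Finset.coe_filter, Set.mem_ofPred_eq] at hz ⊢
      exact ⟨htr z hz.1, hz.2⟩
    calc S.card ≤ 2 ^ d * _ := h1
      _ ≤ 2 ^ d * _ := Nat.mul_le_mul_left _ h2
      _ = _ := by ring

omit [Module (ZMod 2) V] in
lemma der_add (a b : V) (f : V → ZMod 2) :
    der (a + b) f = (fun x => der a f (x + b)) + der b f := by
  funext x
  simp only [der, Pi.add_apply, add_assoc x, add_comm b a]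
  linear_combination -ZModModule.add_self (f (x + b))

/-- The directions in which the derivative of `f` is in `Poly m`. -/
def dirs (m : ℕ) (f : V → ZMod 2) : Submodule (ZMod 2) V where
  carrier := {a | Poly m (der a f)}
  zero_mem' := by
    simp only [Set.mem_ofPred_eq, der_zero]
    exact Poly.zero_fun m
  add_mem' := by
    intro a b ha hb
    simp only [Set.mem_ofPred_eq, der_add] at *
    exact (ha.shift b).add hb
  smul_mem' := by
    intro c a ha
    rcases zmod2_cases c with rfl | rfl
    · simp only [zero_smul, Set.mem_ofPred_eq, der_zero]
      exact Poly.zero_fun m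
    · simpa using ha

lemma mem_dirs {m : ℕ} {f : V → ZMod 2} {a : V} : a ∈ dirs m f ↔ Poly m (der a f) := Iff.rfl

variable [Fintype V]

lemma card_dirs_le {m : ℕ} {f : V → ZMod 2} (hf : ¬ Poly (m + 1) f) :
    Nat.card (dirs m f) * 2 ^ (m + 1) ≤ Fintype.card V := by
  simp only [Poly, not_forall] at hf
  obtain ⟨a, x, hax⟩ := hf
  have hli : LinearIndependent (ZMod 2) ((dirs m f).mkQ ∘ a) := by
    rw [Fintype.linearIndependent_iff]
    intro u hu i
    by_contra hi
    refine hax (flat_eq_zero_of_der (u := u) (fun h0 => hi (by simp [h0])) ?_ x)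
    rw [← mem_dirs, ← Submodule.Quotient.mk_eq_zero, ← Submodule.mkQ_apply, comb, map_sum, ← hu]
    simp
  have h1 := hli.fintype_card_le_finrank
  rw [Fintype.card_fin] at h1
  rw [← Nat.card_eq_fintype_card, (dirs m f).card_eq_card_quotient_mul_card]
  refine Nat.mul_le_mul_left _ ?_
  rw [Module.natCard_eq_pow_finrank (K := ZMod 2), Nat.card_zmod]
  exact Nat.pow_le_pow_right two_pos h1

omit [AddCommGroup V] [Module (ZMod 2) V] in
lemma sum_fin_succ {M : Type*} [AddCommMonoid M] {m : ℕ} (F : (Fin (m + 1) → V) → M) :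
    ∑ a, F a = ∑ b : V, ∑ a : Fin m → V, F (Fin.cons b a) := by
  rw [← (Fin.consEquiv (fun _ => V)).sum_comp, Fintype.sum_prod_type]
  rfl

/-- The number of direction tuples whose derivative of `f` is not identically zero. -/
def nzDirs (m : ℕ) (f : V → ZMod 2) : ℕ :=
  (Finset.univ.filter fun a : Fin m → V => ∃ x, flat f a x ≠ 0).card

lemma nzDirs_succ (m : ℕ) (f : V → ZMod 2) : nzDirs (m + 1) f = ∑ b, nzDirs m (der b f) := by
  simp only [nzDirs, Finset.card_filter, sum_fin_succ, flat_cons]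

lemma prod_le_nzDirs (m : ℕ) : ∀ f : V → ZMod 2, ¬ Poly m f →
    (∏ j ∈ Finset.range m, (1 - (1 / 2 : ℝ) ^ (j + 1))) * (Fintype.card V : ℝ) ^ m ≤ nzDirs m f := by
  induction m with
  | zero =>
    intro f hf
    simp only [Poly, not_forall] at hf
    obtain ⟨a, x, hax⟩ := hf
    have : 0 < nzDirs 0 f := Finset.card_pos.2 ⟨a, Finset.mem_filter.2 ⟨Finset.mem_univ _, x, hax⟩⟩
    simpa using Nat.one_le_iff_ne_zero.2 this.ne'
  | succ m ih =>
    intro f hf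
    set p := ∏ j ∈ Finset.range m, (1 - (1 / 2 : ℝ) ^ (j + 1)) with hp
    have hp0 : 0 ≤ p := Finset.prod_nonneg fun j _ =>
      sub_nonneg.2 (pow_le_one₀ (by norm_num) (by norm_num))
    set N : ℝ := (Fintype.card V : ℝ) with hN
    have hgood : N * (1 - (1 / 2 : ℝ) ^ (m + 1)) ≤
        ((Finset.univ.filter fun b : V => ¬ Poly m (der b f)).card : ℝ) := by
      have h1 := Finset.card_filter_add_card_filter_not (s := (Finset.univ : Finset V))
        (fun b : V => Poly m (der b f))
      have h2 : (Finset.univ.filter fun b : V => Poly m (der b f)).card = Nat.card (dirs m f) := by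
        rw [Nat.card_eq_fintype_card, Fintype.card_subtype]
        rfl
      have h3 := card_dirs_le hf
      rw [Finset.card_univ, h2] at h1
      have h1' : (Nat.card (dirs m f) : ℝ) +
        ((Finset.univ.filter fun b : V => ¬ Poly m (der b f)).card : ℝ) = N := by
        rw [hN]; exact_mod_cast h1
      have h3' : (Nat.card (dirs m f) : ℝ) * 2 ^ (m + 1) ≤ N := by
        rw [hN]; exact_mod_cast h3
      rw [← le_div_iff₀ (by positivity)] at h3'
      have h4 : N * (1 / 2 : ℝ) ^ (m + 1) = N / 2 ^ (m + 1) := by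
        rw [one_div, inv_pow, div_eq_mul_inv]
      rw [mul_sub, mul_one, h4]
      linarith
    rw [nzDirs_succ, Finset.prod_range_succ, ← hp]
    push_cast
    calc p * (1 - (1 / 2 : ℝ) ^ (m + 1)) * N ^ (m + 1)
        = N * (1 - (1 / 2 : ℝ) ^ (m + 1)) * (p * N ^ m) := by ring
      _ ≤ ((Finset.univ.filter fun b : V => ¬ Poly m (der b f)).card : ℝ) * (p * N ^ m) :=
          mul_le_mul_of_nonneg_right hgood (by positivity)
      _ = ∑ b ∈ Finset.univ.filter fun b : V => ¬ Poly m (der b f), p * N ^ m := by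
          rw [Finset.sum_const, nsmul_eq_mul]
      _ ≤ ∑ b ∈ Finset.univ.filter fun b : V => ¬ Poly m (der b f), (nzDirs m (der b f) : ℝ) :=
          Finset.sum_le_sum fun b hb => ih _ (Finset.mem_filter.1 hb).2
      _ ≤ ∑ b, (nzDirs m (der b f) : ℝ) :=
          Finset.sum_le_sum_of_subset_of_nonneg (Finset.filter_subset _ _)
            fun _ _ _ => Nat.cast_nonneg _

lemma quarter_le_prod (m : ℕ) :
    (1 / 4 : ℝ) ≤ ∏ j ∈ Finset.range m, (1 - (1 / 2 : ℝ) ^ (j + 1)) := by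
  have key : ∀ k : ℕ, (1 / 4 : ℝ) + (1 / 2) ^ (k + 2) ≤
      ∏ j ∈ Finset.range (k + 1), (1 - (1 / 2 : ℝ) ^ (j + 1)) := by
    intro k
    induction k with
    | zero => norm_num
    | succ k ih =>
      rw [Finset.prod_range_succ]
      have h1 : (1 / 2 : ℝ) ^ (k + 2) ≤ 1 / 4 := by
        calc (1 / 2 : ℝ) ^ (k + 2) ≤ (1 / 2) ^ 2 :=
              pow_le_pow_of_le_one (by norm_num) (by norm_num) (by omega)
          _ = 1 / 4 := by norm_num
      have h0 : (0 : ℝ) < (1 / 2 : ℝ) ^ (k + 2) := by positivity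
      have e1 : (1 / 2 : ℝ) ^ (k + 1 + 2) = (1 / 2) ^ (k + 2) / 2 := by ring
      rw [e1]
      refine le_trans ?_ (mul_le_mul_of_nonneg_right ih (by
        rw [sub_nonneg]; exact pow_le_one₀ (by norm_num) (by norm_num)))
      rw [show k + 1 + 1 = k + 2 from rfl]
      nlinarith
  cases m with
  | zero => norm_num
  | succ k => exact le_trans (by simp) (key k)

/-- The number of rejecting choices in the `m`-fold derivative test. -/
def rej (m : ℕ) (f : V → ZMod 2) : ℕ :=
  (Finset.univ.filter fun p : V × (Fin m → V) => flat f p.2 p.1 ≠ 0).card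

lemma rej_eq_sum (m : ℕ) (f : V → ZMod 2) :
    rej m f = ∑ a : Fin m → V, (Finset.univ.filter fun x => flat f a x ≠ 0).card := by
  simp only [rej, Finset.card_filter, Fintype.sum_prod_type_right]

lemma two_pow_le_card_flat_ne_zero {m : ℕ} {f : V → ZMod 2} {a : Fin m → V} {x : V}
    (h : flat f a x ≠ 0) : 2 ^ m ≤ (Finset.univ.filter fun x => flat f a x ≠ 0).card := by
  have hli := linearIndependent_of_flat_ne_zero h
  have hcard : (Finset.univ : Finset (Fin m → ZMod 2)).card = 2 ^ m := by
    rw [Finset.card_univ, Fintype.card_fun, ZMod.card, Fintype.card_fin]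
  rw [← hcard]
  refine Finset.card_le_card_of_injOn (fun u => x + comb a u) (fun u _ => ?_) fun u _ v _ huv => ?_
  · simpa [flat_add_comb] using h
  · have := add_left_cancel huv
    rw [Fintype.linearIndependent_iff] at hli
    funext i
    refine sub_eq_zero.1 (hli (u - v) ?_ i)
    simp only [Pi.sub_apply, sub_smul, Finset.sum_sub_distrib]
    exact sub_eq_zero.2 this

lemma two_pow_mul_le_rej {m : ℕ} {f : V → ZMod 2} (hf : ¬ Poly m f) :
    (2 : ℝ) ^ m * (Fintype.card V : ℝ) ^ m ≤ 4 * rej m f := by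
  have h1 : nzDirs m f * 2 ^ m ≤ rej m f := by
    rw [rej_eq_sum, nzDirs, ← smul_eq_mul, ← Finset.sum_const]
    refine (Finset.sum_le_sum fun a ha => ?_).trans
      (Finset.sum_le_sum_of_subset (Finset.filter_subset _ _))
    obtain ⟨x, hx⟩ := (Finset.mem_filter.1 ha).2
    exact two_pow_le_card_flat_ne_zero hx
  have h1' : (nzDirs m f : ℝ) * 2 ^ m ≤ rej m f := by exact_mod_cast h1
  have h2 := prod_le_nzDirs m f hf
  have h3 := mul_le_mul_of_nonneg_right (quarter_le_prod m)
    (show (0 : ℝ) ≤ (Fintype.card V : ℝ) ^ m by positivity)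
  have h4 := mul_le_mul_of_nonneg_right (h3.trans h2) (show (0 : ℝ) ≤ 2 ^ m by positivity)
  linarith

/-- At most half of the choices reject. -/
lemma two_mul_rej_succ_le (m : ℕ) (f : V → ZMod 2) :
    2 * rej (m + 1) f ≤ Fintype.card V ^ (m + 2) := by
  have h1 : ∀ a : Fin m → V, 2 * ∑ b, (Finset.univ.filter fun x =>
      flat f a (x + b) + flat f a x ≠ 0).card ≤ Fintype.card V ^ 2 := by
    intro a
    set G := Finset.univ.filter fun x => flat f a x ≠ 0
    have h2 : ∑ b, (Finset.univ.filter fun x => flat f a (x + b) + flat f a x ≠ 0).card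
        = 2 * (G.card * Gᶜ.card) := by
      have e1 : ∑ b, (Finset.univ.filter fun x => flat f a (x + b) + flat f a x ≠ 0).card
          = ∑ x, ∑ y, if flat f a y + flat f a x ≠ 0 then 1 else 0 := by
        simp only [Finset.card_filter]
        rw [Finset.sum_comm]
        exact Finset.sum_congr rfl fun x _ => Equiv.sum_comp (Equiv.addLeft x)
          (fun y => if flat f a y + flat f a x ≠ 0 then 1 else 0)
      rw [e1, ← Finset.sum_add_sum_compl G, two_mul]
      congr 1
      · rw [← smul_eq_mul, ← Finset.sum_const]
        refine Finset.sum_congr rfl fun x hx => ?_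
        rw [← Finset.card_filter]
        congr 1
        ext y
        have hx' := zmod2_ne_zero.1 (Finset.mem_filter.1 hx).2
        rcases zmod2_cases (flat f a y) with h | h <;> simp [G, hx', h, ZModModule.add_self]
      · rw [mul_comm, ← smul_eq_mul, ← Finset.sum_const]
        refine Finset.sum_congr rfl fun x hx => ?_
        rw [← Finset.card_filter]
        congr 1
        ext y
        have hx' : flat f a x = 0 := by simpa [G] using hx
        simp [G, hx']
    have h3 := Finset.card_add_card_compl G
    rw [h2, ← h3]
    nlinarith [sq_nonneg ((G.card : ℤ) - Gᶜ.card), show ((4 * (G.card * Gᶜ.card) : ℕ) : ℤ)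
      ≤ (((G.card + Gᶜ.card) ^ 2 : ℕ) : ℤ) by
        push_cast; nlinarith [sq_nonneg ((G.card : ℤ) - Gᶜ.card)]]
  have h2 : rej (m + 1) f = ∑ a : Fin m → V, ∑ b, (Finset.univ.filter fun x =>
      flat f a (x + b) + flat f a x ≠ 0).card := by
    rw [rej_eq_sum, sum_fin_succ, Finset.sum_comm]
    simp only [flat_cons, flat_der]
  rw [h2, Finset.mul_sum]
  refine (Finset.sum_le_sum fun a _ => h1 a).trans ?_
  rw [Finset.sum_const, Finset.card_univ, Fintype.card_fun, Fintype.card_fin, smul_eq_mul, ← pow_add]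

end FlatTest

namespace FlatTest

variable {V : Type} [AddCommGroup V] [Module (ZMod 2) V]

/-- The sum of a real function over a flat. -/
def flatSum {m : ℕ} (φ : V → ℝ) (a : Fin m → V) (x : V) : ℝ :=
  ∑ u : Fin m → ZMod 2, φ (x + comb a u)

lemma flatSum_cons {m : ℕ} (φ : V → ℝ) (b : V) (a : Fin m → V) (x : V) :
    flatSum φ (Fin.cons b a : Fin (m + 1) → V) x = flatSum (fun y => φ y + φ (y + b)) a x := by
  rw [flatSum, ← (Fin.consEquiv (fun _ => ZMod 2)).sum_comp, Fintype.sum_prod_type, sum_zmod2,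
    ← Finset.sum_add_distrib]
  refine Finset.sum_congr rfl fun u _ => ?_
  simp only [comb, Fin.consEquiv, Equiv.coe_fn_mk, Fin.sum_univ_succ, Fin.cons_zero, Fin.cons_succ,
    zero_smul, zero_add, one_smul]
  congr 2
  abel

variable [Fintype V]

omit [Module (ZMod 2) V] in
lemma sum_shift (φ : V → ℝ) (b : V) : ∑ x, φ (x + b) = ∑ x, φ x :=
  Equiv.sum_comp (Equiv.addRight b) φ

lemma sum_flatSum {m : ℕ} (φ : V → ℝ) (a : Fin m → V) :
    ∑ x, flatSum φ a x = 2 ^ m * ∑ x, φ x := by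
  simp only [flatSum]
  rw [Finset.sum_comm]
  simp only [sum_shift, Finset.sum_const, Finset.card_univ, Fintype.card_fun, ZMod.card,
    Fintype.card_fin, nsmul_eq_mul]
  push_cast
  ring

lemma sum_flatSum_sq (m : ℕ) : ∀ φ : V → ℝ,
    (Fintype.card V : ℝ) * ∑ a : Fin m → V, ∑ x, flatSum φ a x ^ 2 =
      (Fintype.card V : ℝ) ^ m * (2 ^ m * Fintype.card V * ∑ x, φ x ^ 2
        + (4 ^ m - 2 ^ m) * (∑ x, φ x) ^ 2) := by
  induction m with
  | zero =>
    intro φ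
    simp [flatSum, comb]
  | succ m ih =>
    intro φ
    rw [sum_fin_succ, Finset.mul_sum]
    simp only [flatSum_cons, ih]
    rw [← Finset.mul_sum, Finset.sum_add_distrib, ← Finset.mul_sum, ← Finset.mul_sum]
    have h1 : ∀ b, ∑ x, (φ x + φ (x + b)) = 2 * ∑ x, φ x := fun b => by
      rw [Finset.sum_add_distrib, sum_shift, two_mul]
    have h2 : ∑ b, ∑ x, (φ x + φ (x + b)) ^ 2 =
        2 * Fintype.card V * ∑ x, φ x ^ 2 + 2 * (∑ x, φ x) ^ 2 := by
      have e1 : ∀ b, ∑ x, (φ x + φ (x + b)) ^ 2 =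
          2 * ∑ x, φ x ^ 2 + 2 * ∑ x, φ x * φ (x + b) := fun b => by
        simp only [add_sq, Finset.sum_add_distrib]
        rw [sum_shift (fun x => φ x ^ 2), Finset.mul_sum, Finset.mul_sum, ← Finset.sum_add_distrib,
          ← Finset.sum_add_distrib, ← Finset.sum_add_distrib]
        exact Finset.sum_congr rfl fun x _ => by ring
      simp only [e1, Finset.sum_add_distrib, Finset.sum_const, Finset.card_univ, nsmul_eq_mul]
      rw [← Finset.mul_sum, Finset.sum_comm]
      simp only [← Finset.mul_sum]
      have e2 : ∀ x, ∑ b, φ (x + b) = ∑ b, φ b := fun x => Equiv.sum_comp (Equiv.addLeft x) φ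
      simp only [e2, ← Finset.sum_mul]
      ring
    simp only [h1, h2, Finset.sum_const, Finset.card_univ, nsmul_eq_mul]
    ring

/-- The number of points where `f` and `g` differ. -/
def dist (f g : V → ZMod 2) : ℕ := (Finset.univ.filter fun x => f x ≠ g x).card

omit [Fintype V] in
lemma flat_eq_flat_add {m : ℕ} {f g : V → ZMod 2} (hg : Poly m g) (a : Fin m → V) (x : V) :
    flat f a x = flat (f + g) a x := by
  rw [flat_add, hg, add_zero]

/-- The real indicator of `f ≠ g`. -/
def neInd (f g : V → ZMod 2) (x : V) : ℝ := if f x ≠ g x then 1 else 0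

omit [AddCommGroup V] [Module (ZMod 2) V] in
lemma sum_neInd (f g : V → ZMod 2) : ∑ x, neInd f g x = dist f g := by
  push_cast [neInd, dist, Finset.card_filter]
  rfl

omit [Fintype V] in
lemma flatSum_neInd {m : ℕ} {f g : V → ZMod 2} (hg : Poly m g) (a : Fin m → V) (x : V) :
    ∃ k : ℕ, flatSum (neInd f g) a x = k ∧ flat f a x = k := by
  refine ⟨∑ u : Fin m → ZMod 2, if f (x + comb a u) ≠ g (x + comb a u) then 1 else 0, ?_, ?_⟩
  · simp only [flatSum, neInd]
    push_cast
    rfl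
  · rw [flat_eq_flat_add hg, flat]
    push_cast
    refine Finset.sum_congr rfl fun u _ => ?_
    split_ifs with h
    · exact zmod2_ne_zero.1 fun h0 => h (zmod2_add_eq_zero.1 h0)
    · exact zmod2_add_eq_zero.2 (not_not.1 h)

lemma rej_eq_sum_real (m : ℕ) (f : V → ZMod 2) :
    (rej m f : ℝ) = ∑ a : Fin m → V, ∑ x, if flat f a x ≠ 0 then (1 : ℝ) else 0 := by
  rw [rej_eq_sum]
  push_cast [Finset.card_filter]
  rfl

lemma sum_sum_flatSum_neInd (m : ℕ) (f g : V → ZMod 2) :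
    ∑ a : Fin m → V, ∑ x, flatSum (neInd f g) a x =
      2 ^ m * (Fintype.card V : ℝ) ^ m * dist f g := by
  simp only [sum_flatSum, sum_neInd, Finset.sum_const, Finset.card_univ, Fintype.card_fun,
    Fintype.card_fin, nsmul_eq_mul]
  push_cast
  ring

lemma rej_le_dist {m : ℕ} {f g : V → ZMod 2} (hg : Poly m g) :
    (rej m f : ℝ) ≤ 2 ^ m * (Fintype.card V : ℝ) ^ m * dist f g := by
  rw [rej_eq_sum_real, ← sum_sum_flatSum_neInd]
  refine Finset.sum_le_sum fun a _ => Finset.sum_le_sum fun x _ => ?_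
  obtain ⟨k, hk, hk'⟩ := flatSum_neInd hg a x (f := f)
  rw [hk]
  split_ifs with h
  · have : k ≠ 0 := fun h0 => h (by rw [hk', h0, Nat.cast_zero])
    exact_mod_cast Nat.one_le_iff_ne_zero.2 this
  · positivity

lemma dist_le_rej {m : ℕ} {f g : V → ZMod 2} (hg : Poly m g) :
    2 ^ m * (dist f g : ℝ) * (Fintype.card V : ℝ) ^ m * (Fintype.card V - 2 ^ m * dist f g) ≤
      Fintype.card V * rej m f := by
  have h1 : 2 * ∑ a : Fin m → V, ∑ x, flatSum (neInd f g) a x -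
      ∑ a : Fin m → V, ∑ x, flatSum (neInd f g) a x ^ 2 ≤ rej m f := by
    rw [rej_eq_sum_real, Finset.mul_sum, ← Finset.sum_sub_distrib]
    refine Finset.sum_le_sum fun a _ => ?_
    rw [Finset.mul_sum, ← Finset.sum_sub_distrib]
    refine Finset.sum_le_sum fun x _ => ?_
    obtain ⟨k, hk, hk'⟩ := flatSum_neInd hg a x (f := f)
    rw [hk]
    rcases k with _ | _ | k
    · rw [if_neg (by simp [hk'])]; norm_num
    · rw [if_pos (by simp [hk'])]; norm_num
    · refine le_trans ?_ (show (0 : ℝ) ≤ _ by split_ifs <;> norm_num)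
      push_cast
      nlinarith [show (0 : ℝ) ≤ k from Nat.cast_nonneg k]
  have h2 := sum_flatSum_sq m (neInd f g)
  have h3 : ∑ x, neInd f g x ^ 2 = dist f g := by
    rw [← sum_neInd]
    exact Finset.sum_congr rfl fun x _ => by unfold neInd; split_ifs <;> norm_num
  rw [h3, sum_neInd] at h2
  rw [sum_sum_flatSum_neInd] at h1
  have h4 := mul_le_mul_of_nonneg_left h1 (show (0 : ℝ) ≤ Fintype.card V by positivity)
  rw [mul_sub, h2] at h4
  refine le_trans ?_ h4
  have h5 : (0 : ℝ) ≤ (Fintype.card V : ℝ) ^ m * 2 ^ m * (dist f g : ℝ) ^ 2 := by positivity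
  have h6 : (4 : ℝ) ^ m = 2 ^ m * 2 ^ m := by rw [← mul_pow]; norm_num
  rw [h6]
  nlinarith

end FlatTest

namespace FlatTest

variable {V : Type} [AddCommGroup V] [Module (ZMod 2) V]

/-- Polynomials that agree on the pairwise intersections of hyperplanes glue to a polynomial, on
hyperplanes whose linear forms generate all the given ones. -/
lemma exists_glue {m : ℕ} (H : Finset (Module.Dual (ZMod 2) V × ZMod 2))
    (G : Module.Dual (ZMod 2) V × ZMod 2 → V → ZMod 2) (hG : ∀ h ∈ H, Poly m (G h))
    (hcons : ∀ h ∈ H, ∀ k ∈ H, ∀ x, h.1 x = h.2 → k.1 x = k.2 → G h x = G k x) :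
    ∃ T ⊆ H, ∃ Q : V → ZMod 2, Poly m Q ∧ (∀ h ∈ T, ∀ x, h.1 x = h.2 → Q x = G h x) ∧
      ∀ h ∈ H, ∀ v, (∀ k ∈ T, k.1 v = 0) → h.1 v = 0 := by
  induction H using Finset.induction_on with
  | empty => exact ⟨∅, subset_rfl, 0, Poly.zero_fun m, by simp, by simp⟩
  | insert h H _ ih =>
    obtain ⟨T, hT, Q, hQ, hQT, hker⟩ := ih (fun k hk => hG k (Finset.mem_insert_of_mem hk))
      (fun k hk l hl => hcons k (Finset.mem_insert_of_mem hk) l (Finset.mem_insert_of_mem hl))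
    by_cases hc : ∀ v, (∀ k ∈ T, k.1 v = 0) → h.1 v = 0
    · refine ⟨T, hT.trans (Finset.subset_insert _ _), Q, hQ, hQT, fun k hk v hv => ?_⟩
      rcases Finset.mem_insert.1 hk with rfl | hk
      · exact hc v hv
      · exact hker k hk v hv
    · push Not at hc
      obtain ⟨v, hv, hhv⟩ := hc
      rw [zmod2_ne_zero] at hhv
      set φ : V →ₗ[ZMod 2] V := LinearMap.id + h.1.smulRight v with hφ
      have hπ : ∀ x, φ x + h.2 • v = x + (h.1 x + h.2) • v := fun x => by
        rw [hφ, LinearMap.add_apply, LinearMap.id_apply, LinearMap.smulRight_apply, add_smul,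
          add_assoc]
      have hhH := Finset.mem_insert_self h H
      refine ⟨insert h T, Finset.insert_subset_insert _ hT,
        Q + fun x => (G h + Q) (φ x + h.2 • v),
        hQ.add (((hG h hhH).add hQ).comp φ _), ?_, ?_⟩
      · intro k hk x hx
        rcases Finset.mem_insert.1 hk with rfl | hk
        · simp only [Pi.add_apply, hπ, hx, ZModModule.add_self, zero_smul, add_zero]
          linear_combination ZModModule.add_self (Q x)
        · have hk1 : k.1 (φ x + h.2 • v) = k.2 := by
            rw [hπ, map_add, map_smul, hv k hk, smul_zero, add_zero, hx]
          have hh1 : h.1 (φ x + h.2 • v) = h.2 := by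
            rw [hπ, map_add, map_smul, hhv, smul_eq_mul]
            linear_combination ZModModule.add_self (h.1 x)
          simp only [Pi.add_apply]
          rw [hQT k hk _ hk1, hcons h hhH k (Finset.mem_insert_of_mem (hT hk)) _ hh1 hk1,
            ZModModule.add_self, add_zero, hQT k hk x hx]
      · intro k hk w hw
        rcases Finset.mem_insert.1 hk with rfl | hk
        · exact hw k (Finset.mem_insert_self _ _)
        · exact hker k hk w fun l hl => hw l (Finset.mem_insert_of_mem hl)

variable [Fintype V]

instance : Fintype (Module.Dual (ZMod 2) V) :=
  Fintype.ofInjective (fun L : Module.Dual (ZMod 2) V => (L : V → ZMod 2)) DFunLike.coe_injective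

lemma card_annihilator (W : Submodule (ZMod 2) V) :
    (Finset.univ.filter fun L : Module.Dual (ZMod 2) V => ∀ w ∈ W, L w = 0).card * Nat.card W =
      Fintype.card V := by
  have h1 : (Finset.univ.filter fun L : Module.Dual (ZMod 2) V => ∀ w ∈ W, L w = 0).card =
      Nat.card W.dualAnnihilator := by
    rw [Nat.card_eq_fintype_card, Fintype.card_subtype]
    simp only [Submodule.mem_dualAnnihilator]
  rw [h1, ← Nat.card_eq_fintype_card, Module.natCard_eq_pow_finrank (K := ZMod 2),
    Module.natCard_eq_pow_finrank (K := ZMod 2) (V := W),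
    Module.natCard_eq_pow_finrank (K := ZMod 2) (V := V), ← pow_add, add_comm,
    Subspace.finrank_add_finrank_dualAnnihilator_eq]

lemma card_dual : Fintype.card (Module.Dual (ZMod 2) V) = Fintype.card V := by
  have h := card_annihilator (⊥ : Submodule (ZMod 2) V)
  simpa using h

/-- The sign character of `𝔽₂`. -/
def sgn (c : ZMod 2) : ℝ := if c = 0 then 1 else -1

lemma sgn_mul (c e : ZMod 2) : sgn c * sgn e = sgn (c + e) := by
  rcases zmod2_cases c with rfl | rfl <;> rcases zmod2_cases e with rfl | rfl <;>
    simp [sgn, ZModModule.add_self]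

lemma sgn_add_one (c : ZMod 2) : sgn (c + 1) = -sgn c := by
  rcases zmod2_cases c with rfl | rfl <;> simp [sgn, ZModModule.add_self]

lemma sum_sgn {L : Module.Dual (ZMod 2) V} (hL : L ≠ 0) (c : ZMod 2) :
    ∑ x, sgn (L x + c) = 0 := by
  obtain ⟨v, hv⟩ : ∃ v, L v ≠ 0 := by
    by_contra! h
    exact hL (LinearMap.ext h)
  rw [zmod2_ne_zero] at hv
  have h := sum_shift (fun x => sgn (L x + c)) v
  have h2 : ∀ x, sgn (L (x + v) + c) = -sgn (L x + c) := fun x => by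
    rw [map_add, hv, add_right_comm, sgn_add_one]
  simp only [h2, Finset.sum_neg_distrib] at h
  linarith

/-- The points of the hyperplane `h`. -/
def hplane (h : Module.Dual (ZMod 2) V × ZMod 2) : Finset V :=
  Finset.univ.filter fun x => h.1 x = h.2

lemma mem_hplane {h : Module.Dual (ZMod 2) V × ZMod 2} {x : V} :
    x ∈ hplane h ↔ h.1 x = h.2 := by
  simp [hplane]

lemma sgn_eq (h : Module.Dual (ZMod 2) V × ZMod 2) (x : V) :
    sgn (h.1 x + h.2) = 2 * (if x ∈ hplane h then 1 else 0) - 1 := by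
  simp only [sgn, mem_hplane, zmod2_add_eq_zero]
  split_ifs <;> norm_num

lemma card_hplane {h : Module.Dual (ZMod 2) V × ZMod 2} (hh : h.1 ≠ 0) :
    2 * ((hplane h).card : ℝ) = Fintype.card V := by
  have h1 := sum_sgn hh h.2
  simp only [sgn_eq, Finset.sum_sub_distrib, ← Finset.mul_sum, Finset.sum_boole,
    Finset.filter_univ_mem, Finset.sum_const, Finset.card_univ, nsmul_eq_mul, mul_one] at h1
  linarith

lemma sum_sgn_mul {h k : Module.Dual (ZMod 2) V × ZMod 2} (hne : h.1 ≠ k.1) :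
    ∑ x, sgn (h.1 x + h.2) * sgn (k.1 x + k.2) = 0 := by
  have hne' : h.1 + k.1 ≠ 0 := fun h0 => hne (by
    rw [← sub_eq_zero, ZModModule.sub_eq_add, h0])
  rw [← sum_sgn hne' (h.2 + k.2)]
  refine Finset.sum_congr rfl fun x _ => ?_
  rw [sgn_mul, LinearMap.add_apply]
  congr 1
  ring

lemma card_hplane_inter {h k : Module.Dual (ZMod 2) V × ZMod 2} (hh : h.1 ≠ 0) (hk : k.1 ≠ 0)
    (hne : h.1 ≠ k.1) : 4 * ((hplane h ∩ hplane k).card : ℝ) = Fintype.card V := by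
  have h1 := sum_sgn_mul hne
  have h2 := card_hplane hh
  have h3 := card_hplane hk
  have h4 : ∀ x, sgn (h.1 x + h.2) * sgn (k.1 x + k.2) =
      4 * (if x ∈ hplane h ∩ hplane k then 1 else 0) - 2 * (if x ∈ hplane h then 1 else 0)
        - 2 * (if x ∈ hplane k then 1 else 0) + 1 := fun x => by
    rw [sgn_eq, sgn_eq]
    simp only [Finset.mem_inter]
    by_cases p : x ∈ hplane h <;> by_cases q : x ∈ hplane k <;> simp [p, q] <;> norm_num
  simp only [h4, Finset.sum_sub_distrib, Finset.sum_add_distrib, ← Finset.mul_sum, Finset.sum_boole,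
    Finset.filter_univ_mem, Finset.sum_const, Finset.card_univ, nsmul_eq_mul, mul_one] at h1
  linarith

/-- Few points lie on fewer than a third of the hyperplanes of a family. -/
lemma card_light_le (H : Finset (Module.Dual (ZMod 2) V × ZMod 2)) :
    ((Finset.univ.filter fun x : V =>
      3 * ((H.filter fun h => x ∈ hplane h).card : ℝ) < H.card).card : ℝ) * H.card ≤
      9 * Fintype.card V := by
  rcases H.eq_empty_or_nonempty with rfl | hne
  · simp
  have hK : (0 : ℝ) < H.card := by exact_mod_cast hne.card_pos
  set S : V → ℝ := fun x => ∑ h ∈ H, sgn (h.1 x + h.2) with hS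
  have hSx : ∀ x, S x = 2 * ((H.filter fun h => x ∈ hplane h).card : ℝ) - H.card := fun x => by
    simp only [hS, sgn_eq, Finset.sum_sub_distrib, ← Finset.mul_sum]
    simp
  have h1 : ∑ x, S x ^ 2 ≤ H.card * Fintype.card V := by
    have e1 : ∑ x, S x ^ 2 = ∑ h ∈ H, ∑ k ∈ H, ∑ x, sgn (h.1 x + h.2) * sgn (k.1 x + k.2) := by
      simp only [hS, sq, Finset.sum_mul_sum]
      rw [Finset.sum_comm]
      exact Finset.sum_congr rfl fun h _ => Finset.sum_comm
    rw [e1, ← nsmul_eq_mul, ← Finset.sum_const]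
    refine Finset.sum_le_sum fun h hh => ?_
    rw [← Finset.add_sum_erase _ _ hh]
    have e2 : ∑ x, sgn (h.1 x + h.2) * sgn (h.1 x + h.2) = Fintype.card V := by
      simp only [sgn_mul, ZModModule.add_self]
      simp [sgn]
    have e3 : ∑ k ∈ H.erase h, ∑ x, sgn (h.1 x + h.2) * sgn (k.1 x + k.2) ≤ 0 := by
      refine Finset.sum_nonpos fun k hk => ?_
      by_cases hL : h.1 = k.1
      · refine Finset.sum_nonpos fun x _ => ?_
        have hb : h.2 + k.2 ≠ 0 := fun h0 =>
          (Finset.mem_erase.1 hk).1 (Prod.ext hL.symm (zmod2_add_eq_zero.1 h0).symm)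
        rw [sgn_mul, ← hL, show h.1 x + h.2 + (h.1 x + k.2) = h.2 + k.2 by
          linear_combination ZModModule.add_self (h.1 x), sgn, if_neg hb]
        norm_num
      · exact (sum_sgn_mul hL).le
    linarith
  set B := Finset.univ.filter fun x : V =>
    3 * ((H.filter fun h => x ∈ hplane h).card : ℝ) < H.card with hB
  have h2 : (B.card : ℝ) * ((H.card : ℝ) ^ 2 / 9) ≤ ∑ x, S x ^ 2 := by
    rw [← nsmul_eq_mul, ← Finset.sum_const]
    refine (Finset.sum_le_sum fun x hx => ?_).trans
      (Finset.sum_le_sum_of_subset_of_nonneg (Finset.subset_univ B) fun _ _ _ => sq_nonneg _)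
    have hx' := (Finset.mem_filter.1 hx).2
    rw [hSx]
    nlinarith
  have h3 := h2.trans h1
  have h4 : (B.card * H.card : ℝ) * (H.card / 9) ≤ Fintype.card V * (H.card : ℝ) := by linarith
  have h5 : (H.card / 9 : ℝ) * (B.card * H.card - 9 * Fintype.card V) ≤ 0 := by linarith
  by_contra! hcon
  have : 0 < (H.card / 9 : ℝ) * (B.card * H.card - 9 * Fintype.card V) := by
    apply mul_pos <;> linarith
  linarith

end FlatTest

namespace FlatTest

variable {V : Type} [AddCommGroup V] [Module (ZMod 2) V] [Fintype V]

lemma hplane_closed (h : Module.Dual (ZMod 2) V × ZMod 2) :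
    ∀ x ∈ hplane h, ∀ y ∈ hplane h, ∀ z ∈ hplane h, x + y + z ∈ hplane h := by
  intro x hx y hy z hz
  rw [mem_hplane] at *
  rw [map_add, map_add, hx, hy, hz, ZModModule.add_self, zero_add]

/-- A function close to polynomials on many hyperplanes is close to a polynomial. -/
lemma exists_poly_of_hplanes {d : ℕ} {f : V → ZMod 2}
    (H : Finset (Module.Dual (ZMod 2) V × ZMod 2)) (hH : ∀ h ∈ H, h.1 ≠ 0)
    (G : Module.Dual (ZMod 2) V × ZMod 2 → V → ZMod 2) (hG : ∀ h ∈ H, Poly (d + 1) (G h))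
    {α : ℝ} (hα : α * 2 ^ (d + 2) < 1)
    (hclose : ∀ h ∈ H, 2 * (((hplane h).filter fun x => f x ≠ G h x).card : ℝ) ≤
      α * Fintype.card V)
    (hK : 2 ^ (d + 2) < H.card) :
    ∃ Q : V → ZMod 2, Poly (d + 1) Q ∧
      (dist f Q : ℝ) ≤ (3 / 2 * α + 9 / H.card) * Fintype.card V := by
  have hN : (0 : ℝ) < Fintype.card V := by exact_mod_cast Fintype.card_pos
  have hD : (0 : ℝ) < 2 ^ d := by positivity
  have hα' : α * 2 ^ d * 4 < 1 := by rw [pow_add] at hα; linarith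
  have hcons : ∀ h ∈ H, ∀ k ∈ H, ∀ x, h.1 x = h.2 → k.1 x = k.2 → G h x = G k x := by
    intro h hh k hk x hx kx
    by_contra hne
    have hL : h.1 ≠ k.1 := fun h1 => hne (by
      rw [show h = k from Prod.ext h1 (by rw [← hx, ← kx, h1])])
    have h1 := card_le_card_ne_zero (hplane h ∩ hplane k) (fun x hx y hy z hz => by
        rw [Finset.mem_inter] at *
        exact ⟨hplane_closed h x hx.1 y hy.1 z hz.1, hplane_closed k x hx.2 y hy.2 z hz.2⟩)
      d (G h + G k) ((hG h hh).add (hG k hk))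
      ⟨x, Finset.mem_inter.2 ⟨mem_hplane.2 hx, mem_hplane.2 kx⟩,
        fun h0 => hne (zmod2_add_eq_zero.1 h0)⟩
    have h2 : ((hplane h ∩ hplane k).filter fun x => (G h + G k) x ≠ 0).card ≤
        ((hplane h).filter fun x => f x ≠ G h x).card +
        ((hplane k).filter fun x => f x ≠ G k x).card := by
      refine (Finset.card_le_card fun y hy => ?_).trans (Finset.card_union_le _ _)
      simp only [Finset.mem_filter, Finset.mem_inter, Finset.mem_union] at hy ⊢
      by_contra hcon
      push Not at hcon
      refine hy.2 ?_
      rw [Pi.add_apply, ← hcon.1 hy.1.1, ← hcon.2 hy.1.2, ZModModule.add_self]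
    have h3 : ((hplane h ∩ hplane k).card : ℝ) ≤ 2 ^ d *
        (((hplane h).filter fun x => f x ≠ G h x).card +
        ((hplane k).filter fun x => f x ≠ G k x).card) := by
      exact_mod_cast h1.trans (Nat.mul_le_mul_left _ h2)
    have h4 := card_hplane_inter (hH h hh) (hH k hk) hL
    have h5 := hclose h hh
    have h6 := hclose k hk
    have h7 := h3.trans (mul_le_mul_of_nonneg_left
      (show _ ≤ α * Fintype.card V by linarith) hD.le)
    nlinarith
  obtain ⟨T, hT, Q, hQ, hQT, hker⟩ := exists_glue H G hG hcons
  -- The glued polynomial agrees with all the given ones.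
  have hall : ∀ h ∈ H, ∀ x ∈ hplane h, Q x = G h x := by
    intro h hh x hx
    by_contra hne
    have h1 := card_le_card_ne_zero (hplane h) (hplane_closed h) d (Q + G h)
      (hQ.add (hG h hh)) ⟨x, hx, fun h0 => hne (zmod2_add_eq_zero.1 h0)⟩
    let W : Submodule (ZMod 2) V := ⨅ k ∈ T, LinearMap.ker k.1
    have hW : ∀ v, v ∈ W ↔ ∀ k ∈ T, k.1 v = 0 := fun v => by
      simp [W, Submodule.mem_iInf]
    have hout : ∀ y ∈ (hplane h).filter (fun x => (Q + G h) x ≠ 0), ∀ k ∈ T, k.1 y = k.2 + 1 := by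
      intro y hy k hk
      obtain ⟨hy1, hy2⟩ := Finset.mem_filter.1 hy
      by_contra hk1
      have hk2 : k.1 y = k.2 := by
        rcases zmod2_cases (k.1 y) with e | e <;> rcases zmod2_cases k.2 with e' | e' <;>
          simp_all [ZModModule.add_self]
      refine hy2 (zmod2_add_eq_zero.2 ?_)
      rw [hQT k hk y hk2]
      exact hcons k (hT hk) h hh y hk2 (mem_hplane.1 hy1)
    have h2 : ((hplane h).filter fun x => (Q + G h) x ≠ 0).card ≤ Nat.card W := by
      rw [Nat.card_eq_fintype_card, Fintype.card_subtype]
      refine Finset.card_le_card_of_injOn (fun y => y + x) (fun y hy => ?_)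
        fun _ _ _ _ e => add_right_cancel e
      rw [Finset.mem_coe, Finset.mem_filter]
      refine ⟨Finset.mem_univ _, (hW _).2 fun k hk => ?_⟩
      rw [map_add, hout y hy k hk, hout x (Finset.mem_filter.2
        ⟨hx, fun h0 => hne (zmod2_add_eq_zero.1 h0)⟩) k hk, ZModModule.add_self]
    have h3 := card_annihilator W
    have h4 : H.card ≤ 2 * (Finset.univ.filter fun L : Module.Dual (ZMod 2) V =>
        ∀ w ∈ W, L w = 0).card := by
      have : H ⊆ (Finset.univ.filter fun L : Module.Dual (ZMod 2) V =>
          ∀ w ∈ W, L w = 0) ×ˢ Finset.univ := fun k hk => by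
        rw [Finset.mem_product, Finset.mem_filter]
        exact ⟨⟨Finset.mem_univ _, fun w hw => hker k hk w ((hW w).1 hw)⟩, Finset.mem_univ _⟩
      refine (Finset.card_le_card this).trans_eq ?_
      rw [Finset.card_product, Finset.card_univ, ZMod.card, mul_comm]
    have h5 := card_hplane (hH h hh)
    have h6 : 2 * (hplane h).card = Fintype.card V := by exact_mod_cast h5
    have hpos : 0 < Fintype.card V := Fintype.card_pos
    have h7 : H.card * Nat.card W ≤ 2 * Fintype.card V := by
      rw [← h3, ← mul_assoc]
      exact Nat.mul_le_mul_right _ h4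
    have h8 : Fintype.card V ≤ 2 * (2 ^ d * Nat.card W) := by
      rw [← h6]
      exact Nat.mul_le_mul_left _ (h1.trans (Nat.mul_le_mul_left _ h2))
    have hWpos : 0 < Nat.card W := Nat.card_pos
    have h9 := Nat.mul_lt_mul_of_pos_right hK hWpos
    rw [pow_add] at h9
    linarith
  refine ⟨Q, hQ, ?_⟩
  set K : ℝ := (H.card : ℝ) with hKdef
  have hK0 : 0 < K := by
    rw [hKdef]
    exact_mod_cast (Nat.zero_le _).trans_lt hK
  set E := Finset.univ.filter fun x => f x ≠ Q x with hE
  set B := Finset.univ.filter fun x : V =>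
      3 * ((H.filter fun h => x ∈ hplane h).card : ℝ) < H.card with hB
  have hBcard : (B.card : ℝ) ≤ 9 / K * Fintype.card V := by
    rw [div_mul_eq_mul_div, le_div_iff₀ hK0]
    exact card_light_le H
  have hheavy : ((E \ B).card : ℝ) * (K / 3) ≤ K * (α * Fintype.card V / 2) := by
    calc ((E \ B).card : ℝ) * (K / 3) = ∑ x ∈ E \ B, K / 3 := by
          rw [Finset.sum_const, nsmul_eq_mul]
      _ ≤ ∑ x ∈ E \ B, ((H.filter fun h => x ∈ hplane h).card : ℝ) := by
          refine Finset.sum_le_sum fun x hx => ?_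
          have := (Finset.mem_sdiff.1 hx).2
          rw [hB, Finset.mem_filter, not_and] at this
          have := not_lt.1 (this (Finset.mem_univ _))
          linarith
      _ ≤ ∑ x ∈ E, ((H.filter fun h => x ∈ hplane h).card : ℝ) :=
          Finset.sum_le_sum_of_subset_of_nonneg Finset.sdiff_subset fun _ _ _ => Nat.cast_nonneg _
      _ = ∑ h ∈ H, (((hplane h).filter fun x => f x ≠ G h x).card : ℝ) := by
          have e1 : ∀ h ∈ H, ((hplane h).filter fun x => f x ≠ G h x) =
              E.filter fun x => x ∈ hplane h := fun h hh => by
            ext x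
            simp only [Finset.mem_filter, hE, Finset.mem_univ, true_and]
            constructor
            · rintro ⟨h1, h2⟩
              exact ⟨by rwa [hall h hh x h1], h1⟩
            · rintro ⟨h1, h2⟩
              exact ⟨h2, by rwa [← hall h hh x h2]⟩
          have e2 : ∑ h ∈ H, (((hplane h).filter fun x => f x ≠ G h x).card : ℝ) =
              ∑ h ∈ H, ((E.filter fun x => x ∈ hplane h).card : ℝ) :=
            Finset.sum_congr rfl fun h hh => by rw [e1 h hh]
          rw [e2]
          simp only [Finset.card_filter]
          push_cast
          exact Finset.sum_comm
      _ ≤ ∑ h ∈ H, α * Fintype.card V / 2 :=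
          Finset.sum_le_sum fun h hh => by linarith [hclose h hh]
      _ = _ := by rw [Finset.sum_const, nsmul_eq_mul]
  have hheavy' : ((E \ B).card : ℝ) ≤ 3 / 2 * α * Fintype.card V := by
    have : K * (((E \ B).card : ℝ) / 3) ≤ K * (α * Fintype.card V / 2) := by linarith
    have := le_of_mul_le_mul_left this hK0
    linarith
  have hsplit : (E.card : ℝ) ≤ (E \ B).card + B.card := by
    exact_mod_cast (Finset.card_le_card (fun x hx => by
      by_cases hxB : x ∈ B <;> simp [hx, hxB])).trans (Finset.card_union_le (E \ B) B)
  change (E.card : ℝ) ≤ _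
  rw [add_mul]
  linarith

end FlatTest

namespace FlatTest

variable {V : Type} [AddCommGroup V] [Module (ZMod 2) V] [Fintype V]

/-- The number of rejecting choices in the `m`-fold derivative test inside a hyperplane. -/
def rejOn (m : ℕ) (f : V → ZMod 2) (h : Module.Dual (ZMod 2) V × ZMod 2) : ℕ :=
  (Finset.univ.filter fun p : V × (Fin m → V) =>
    flat f p.2 p.1 ≠ 0 ∧ (h.1 p.1 = h.2 ∧ ∀ i, h.1 (p.2 i) = 0)).card

lemma card_span {m : ℕ} {a : Fin m → V} (ha : LinearIndependent (ZMod 2) a) :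
    Nat.card (Submodule.span (ZMod 2) (Set.range a)) = 2 ^ m := by
  rw [Module.natCard_eq_pow_finrank (K := ZMod 2), Nat.card_zmod, finrank_span_eq_card ha,
    Fintype.card_fin]

lemma sum_rejOn_le (m : ℕ) (f : V → ZMod 2) :
    (∑ h ∈ Finset.univ.filter fun h : Module.Dual (ZMod 2) V × ZMod 2 => h.1 ≠ 0, rejOn m f h)
      * 2 ^ m ≤ rej m f * Fintype.card V := by
  have e1 : ∀ h, rejOn m f h = ∑ p ∈ Finset.univ.filter (fun p : V × (Fin m → V) =>
      flat f p.2 p.1 ≠ 0), if h.1 p.1 = h.2 ∧ ∀ i, h.1 (p.2 i) = 0 then 1 else 0 := fun h => by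
    rw [rejOn, ← Finset.card_filter, Finset.filter_filter]
  simp only [e1]
  rw [Finset.sum_comm, rej, Finset.sum_mul, ← smul_eq_mul, ← Finset.sum_const]
  refine Finset.sum_le_sum fun p hp => ?_
  have hli := linearIndependent_of_flat_ne_zero (Finset.mem_filter.1 hp).2
  rw [← card_annihilator (Submodule.span (ZMod 2) (Set.range p.2)), card_span hli,
    ← Finset.card_filter]
  refine Nat.mul_le_mul_right _ (Finset.card_le_card_of_injOn Prod.fst (fun h hh => ?_) ?_)
  · simp only [Finset.coe_filter, Set.mem_ofPred_eq, Finset.mem_filter, Finset.mem_univ,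
      true_and] at hh ⊢
    intro w hw
    refine (Submodule.span_le (p := LinearMap.ker h.1)).2 ?_ hw
    rintro _ ⟨i, rfl⟩
    exact hh.2.2 i
  · intro h hh k hk hhk
    simp only [Finset.coe_filter, Set.mem_ofPred_eq, Finset.mem_filter, Finset.mem_univ,
      true_and] at hh hk
    exact Prod.ext hhk (by rw [← hh.2.1, ← hk.2.1, hhk])

lemma rej_ker_le (m : ℕ) (f : V → ZMod 2) (L : Module.Dual (ZMod 2) V) (v : V) :
    rej m (fun y : LinearMap.ker L => f (y + v)) ≤ rejOn m f (L, L v) := by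
  refine Finset.card_le_card_of_injOn (fun p => ((p.1 : V) + v, fun i => (p.2 i : V)))
    (fun p hp => ?_) ?_
  · simp only [Finset.coe_filter, Set.mem_ofPred_eq, Finset.mem_univ, true_and] at hp ⊢
    refine ⟨?_, by simp, fun i => (p.2 i).2⟩
    exact fun h0 => hp ((flat_comp f (LinearMap.ker L).subtype v p.2 p.1).trans h0)
  · intro p _ q _ hpq
    simp only [Prod.mk.injEq, add_left_inj, SetLike.coe_eq_coe] at hpq
    exact Prod.ext hpq.1 (funext fun i => Subtype.ext (congrFun hpq.2 i))

lemma card_ker {L : Module.Dual (ZMod 2) V} (hL : L ≠ 0) :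
    2 * Fintype.card (LinearMap.ker L) = Fintype.card V := by
  have h1 := card_hplane (h := (L, 0)) hL
  have h2 : Fintype.card (LinearMap.ker L) = (hplane (L, 0)).card :=
    Fintype.card_of_subtype (hplane (L, 0)) fun x =>
      (mem_hplane.trans LinearMap.mem_ker.symm : x ∈ hplane (L, 0) ↔ x ∈ LinearMap.ker L)
  rw [h2]
  exact_mod_cast h1

/-- A polynomial close to the restriction of `f` to a hyperplane extends to the whole space. -/
lemma exists_extend {m : ℕ} {f : V → ZMod 2} {L : Module.Dual (ZMod 2) V} {v : V} (hv : L v = 1)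
    (b : ZMod 2) {g : LinearMap.ker L → ZMod 2} (hg : Poly m g) :
    ∃ G : V → ZMod 2, Poly m G ∧ ((hplane (L, b)).filter fun x => f x ≠ G x).card ≤
      dist (fun y : LinearMap.ker L => f (y + b • v)) g := by
  let φ : V →ₗ[ZMod 2] LinearMap.ker L :=
    (LinearMap.id + L.smulRight v).codRestrict (LinearMap.ker L) fun x => by
      rw [LinearMap.mem_ker, LinearMap.add_apply, map_add, LinearMap.id_apply,
        LinearMap.smulRight_apply, map_smul, hv, smul_eq_mul, mul_one, ZModModule.add_self]
  have hφ : ∀ x, (φ x : V) = x + L x • v := fun x => rfl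
  refine ⟨fun x => g (φ x + 0), hg.comp φ 0, ?_⟩
  refine Finset.card_le_card_of_injOn φ (fun x hx => ?_) fun x hx y hy hxy => ?_
  · simp only [Finset.coe_filter, Set.mem_ofPred_eq, Finset.mem_univ, true_and, mem_hplane,
      add_zero] at hx ⊢
    rw [hφ, hx.1, add_assoc, ZModModule.add_self, add_zero]
    exact hx.2
  · simp only [Finset.coe_filter, Set.mem_ofPred_eq, mem_hplane] at hx hy
    have := congrArg Subtype.val hxy
    rw [hφ, hφ, hx.1, hy.1] at this
    exact add_right_cancel this

end FlatTest

namespace FlatTest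

/-- A function which the derivative test accepts with probability close to one is close to a
polynomial. -/
lemma exists_poly_close (d k : ℕ) : ∀ (V : Type) [AddCommGroup V] [Module (ZMod 2) V] [Fintype V],
    Fintype.card V = 2 ^ k → ∀ f : V → ZMod 2,
      2048 * (rej (d + 1) f : ℝ) <
        (Fintype.card V + 146 * 2 ^ d) * (Fintype.card V : ℝ) ^ (d + 1) →
      ∃ g, Poly (d + 1) g ∧ 8 * 2 ^ d * (dist f g : ℝ) ≤ Fintype.card V := by
  have hD : (1 : ℝ) ≤ 2 ^ d := one_le_pow₀ (by norm_num)
  set D : ℝ := 2 ^ d with hDdef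
  induction k with
  | zero =>
    intro V _ _ _ hV f hf
    by_contra hcon
    have hP : ¬ Poly (d + 1) f := fun hP => hcon ⟨f, hP, by simp [dist]⟩
    have h1 := two_pow_mul_le_rej hP
    rw [pow_succ, ← hDdef] at h1
    rw [hV] at h1 hf
    norm_num at h1 hf
    linarith
  | succ k ih =>
    intro V _ _ _ hV f hf
    set N : ℝ := (Fintype.card V : ℝ) with hN
    have hN0 : 0 < N := by rw [hN]; exact_mod_cast Fintype.card_pos
    by_cases hsmall : N ≤ 512 * D
    · by_contra hcon
      have hP : ¬ Poly (d + 1) f := fun hP => hcon ⟨f, hP, by simpa [dist] using hN0.le⟩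
      have h1 := two_pow_mul_le_rej hP
      rw [pow_succ 2 d, ← hDdef, ← hN] at h1
      have h2 : 512 * (D * 2) * N ^ (d + 1) < (N + 146 * D) * N ^ (d + 1) := by linarith
      have h3 := lt_of_mul_lt_mul_right h2 (by positivity)
      linarith
    push Not at hsmall
    set M : ℝ := N / 2 with hM
    have hM0 : 0 < M := by positivity
    -- The hyperplanes on which the test accepts with high probability.
    set A := Finset.univ.filter fun h : Module.Dual (ZMod 2) V × ZMod 2 => h.1 ≠ 0 with hA
    set H := A.filter fun h => 2048 * (rejOn (d + 1) f h : ℝ) < (M + 146 * D) * M ^ (d + 1) with hH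
    set B := A.filter fun h => ¬ 2048 * (rejOn (d + 1) f h : ℝ) < (M + 146 * D) * M ^ (d + 1)
      with hB
    have hAcard : (A.card : ℝ) = 2 * N - 2 := by
      have e1 : A = (Finset.univ.erase (0 : Module.Dual (ZMod 2) V)) ×ˢ Finset.univ := by
        ext h; simp [hA]
      rw [e1, Finset.card_product, Finset.card_erase_of_mem (Finset.mem_univ _), Finset.card_univ,
        Finset.card_univ, card_dual, ZMod.card, Nat.cast_mul,
        Nat.cast_sub (Nat.one_le_iff_ne_zero.2 Fintype.card_ne_zero)]
      push_cast
      ring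
    have hHB : (H.card : ℝ) + B.card = 2 * N - 2 := by
      rw [← hAcard]
      exact_mod_cast Finset.card_filter_add_card_filter_not _
    have hBcard : (B.card : ℝ) * (N + 292 * D) < 2 * N * (N + 146 * D) := by
      have h1 : (B.card : ℝ) * ((M + 146 * D) * M ^ (d + 1)) ≤
          ∑ h ∈ A, 2048 * (rejOn (d + 1) f h : ℝ) := by
        rw [← nsmul_eq_mul, ← Finset.sum_const]
        exact (Finset.sum_le_sum fun h hh => not_lt.1 (Finset.mem_filter.1 hh).2).trans
          (Finset.sum_le_sum_of_subset_of_nonneg (Finset.filter_subset _ _)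
            fun _ _ _ => by positivity)
      have h2 : (∑ h ∈ A, (rejOn (d + 1) f h : ℝ)) * 2 ^ (d + 1) ≤ rej (d + 1) f * N := by
        rw [hN]
        exact_mod_cast sum_rejOn_le (d + 1) f
      have h3 : (B.card : ℝ) * ((M + 146 * D) * M ^ (d + 1)) * 2 ^ (d + 1) <
          (N + 146 * D) * N ^ (d + 1) * N := by
        rw [← Finset.mul_sum] at h1
        have h4 := mul_le_mul_of_nonneg_right h1 (show (0 : ℝ) ≤ 2 ^ (d + 1) by positivity)
        have h5 := mul_lt_mul_of_pos_right hf hN0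
        linarith
      have h4 : M ^ (d + 1) * 2 ^ (d + 1) = N ^ (d + 1) := by
        rw [← mul_pow, hM]; ring
      have h5 : ((B.card : ℝ) * (M + 146 * D)) * N ^ (d + 1) <
          ((N + 146 * D) * N) * N ^ (d + 1) := by
        rw [← h4] at h3 ⊢
        linarith
      have h6 := lt_of_mul_lt_mul_right h5 (by positivity)
      rw [hM] at h6
      linarith
    have hHcard : 144 * D ≤ (H.card : ℝ) := by
      have h1 : 146 * D < 2 * N - B.card := by
        by_contra! hcon
        have h2 : (2 * N - B.card) * (N + 292 * D) ≤ 146 * D * (N + 292 * D) :=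
          mul_le_mul_of_nonneg_right hcon (by positivity)
        have h3 : 146 * D * (N + 292 * D) ≤ 146 * D * (2 * N) :=
          mul_le_mul_of_nonneg_left (by linarith) (by positivity)
        nlinarith
      linarith
    have hex : ∀ h ∈ H, ∃ G : V → ZMod 2, Poly (d + 1) G ∧
        2 * (((hplane h).filter fun x => f x ≠ G x).card : ℝ) ≤ 1 / (1024 * D) * N := by
      rintro ⟨L, b⟩ hh
      obtain ⟨hhA, hgood⟩ := Finset.mem_filter.1 hh
      have hL : L ≠ 0 := (Finset.mem_filter.1 hhA).2
      obtain ⟨v, hv⟩ : ∃ v, L v ≠ 0 := by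
        by_contra! h
        exact hL (LinearMap.ext h)
      rw [zmod2_ne_zero] at hv
      have hker := card_ker hL
      have hker' : (Fintype.card (LinearMap.ker L) : ℝ) = M := by
        rw [hM, hN, ← hker]
        push_cast
        ring
      set fh : LinearMap.ker L → ZMod 2 := fun y => f (y + b • v) with hfh
      have hrej : 2048 * (rej (d + 1) fh : ℝ) < (M + 146 * D) * M ^ (d + 1) := by
        have h1 := rej_ker_le (d + 1) f L (b • v)
        rw [map_smul, hv, smul_eq_mul, mul_one] at h1
        have h2 : (rej (d + 1) fh : ℝ) ≤ rejOn (d + 1) f (L, b) := by exact_mod_cast h1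
        linarith
      obtain ⟨g, hg, hgd⟩ := ih (LinearMap.ker L)
        (Nat.eq_of_mul_eq_mul_left two_pos (by rw [hker, hV, pow_succ, mul_comm])) fh
        (by rw [hker']; exact hrej)
      obtain ⟨G, hG, hGd⟩ := exists_extend hv b hg
      refine ⟨G, hG, ?_⟩
      have hGd' : (((hplane (L, b)).filter fun x => f x ≠ G x).card : ℝ) ≤ dist fh g := by
        exact_mod_cast hGd
      have h1 := dist_le_rej hg (f := fh)
      rw [hker'] at h1 hgd
      rw [pow_succ 2 d, ← hDdef] at h1
      set e : ℝ := (dist fh g : ℝ) with he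
      have he0 : 0 ≤ e := Nat.cast_nonneg _
      have h2 : D * 2 * e * M ^ (d + 1) * (M * (3 / 4)) ≤
          D * 2 * e * M ^ (d + 1) * (M - D * 2 * e) :=
        mul_le_mul_of_nonneg_left (by linarith) (by positivity)
      have h3 := mul_lt_mul_of_pos_left hrej hM0
      have h4 : (2048 * (3 / 2) * D * e) * (M * M ^ (d + 1)) <
          (M + 146 * D) * (M * M ^ (d + 1)) := by linarith
      have h5 := lt_of_mul_lt_mul_right h4 (by positivity)
      rw [one_div, inv_mul_eq_div, le_div_iff₀ (by positivity)]
      have h6 : D * (((hplane (L, b)).filter fun x => f x ≠ G x).card : ℝ) ≤ D * e :=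
        mul_le_mul_of_nonneg_left hGd' (by positivity)
      linarith
    choose! G hG hGd using hex
    obtain ⟨Q, hQ, hQd⟩ := exists_poly_of_hplanes H
      (fun h hh => (Finset.mem_filter.1 (Finset.mem_filter.1 hh).1).2) G hG
      (α := 1 / (1024 * D)) (by
        rw [pow_add, ← hDdef, one_div, inv_mul_eq_div, div_lt_one (by positivity)]
        linarith) hGd (by
        have : ((2 ^ (d + 2) : ℕ) : ℝ) < H.card := by
          push_cast
          rw [pow_add, ← hDdef]
          linarith
        exact_mod_cast this)
    refine ⟨Q, hQ, ?_⟩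
    have h1 : 9 / (H.card : ℝ) ≤ 1 / (16 * D) := by
      rw [div_le_div_iff₀ (by linarith) (by positivity)]
      linarith
    have h2 : 8 * D * (3 / 2 * (1 / (1024 * D)) + 9 / (H.card : ℝ)) ≤ 1 := by
      have h3 := mul_le_mul_of_nonneg_left h1 (show 0 ≤ 8 * D by positivity)
      have h4 : 8 * D * (1 / (16 * D)) = 1 / 2 := by field_simp; norm_num
      have h5 : 8 * D * (3 / 2 * (1 / (1024 * D))) = 12 / 1024 := by field_simp; norm_num
      rw [mul_add, h5]
      linarith
    calc 8 * D * (dist f Q : ℝ)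
        ≤ 8 * D * ((3 / 2 * (1 / (1024 * D)) + 9 / (H.card : ℝ)) * N) :=
          mul_le_mul_of_nonneg_left hQd (by positivity)
      _ = 8 * D * (3 / 2 * (1 / (1024 * D)) + 9 / (H.card : ℝ)) * N := by ring
      _ ≤ 1 * N := mul_le_mul_of_nonneg_right h2 hN0.le
      _ = N := one_mul N

end FlatTest

namespace FlatTest

section

variable {V : Type} [AddCommGroup V] [Module (ZMod 2) V]

namespace Poly

lemma mono {m k : ℕ} (hmk : m ≤ k) {f : V → ZMod 2} (hf : Poly m f) : Poly k f := by
  induction k, hmk using Nat.le_induction with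
  | base => exact hf
  | succ k _ ih => exact poly_succ.2 fun b => (ih.shift b).add ih

lemma const_mul {m : ℕ} {f : V → ZMod 2} (hf : Poly m f) (c : ZMod 2) :
    Poly m (fun x => c * f x) := by
  rcases zmod2_cases c with rfl | rfl
  · simp only [zero_mul]
    exact zero_fun m
  · simpa using hf

lemma sum {m : ℕ} {ι : Type*} (s : Finset ι) (f : ι → V → ZMod 2) (hf : ∀ i ∈ s, Poly m (f i)) :
    Poly m (fun x => ∑ i ∈ s, f i x) := by
  intro a x
  simp only [flat]
  rw [Finset.sum_comm]
  exact Finset.sum_eq_zero fun i hi => hf i hi a x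

lemma dual_mul (L : Module.Dual (ZMod 2) V) {m : ℕ} : ∀ {f : V → ZMod 2}, Poly m f →
    Poly (m + 1) (fun x => L x * f x) := by
  induction m with
  | zero =>
    intro f hf
    rw [poly_zero.1 hf]
    simp only [Pi.zero_apply, mul_zero]
    exact zero_fun 1
  | succ m ih =>
    intro f hf
    refine poly_succ.2 fun b => ?_
    convert (ih (poly_succ.1 hf b)).add ((hf.shift b).const_mul (L b)) using 1
    funext x
    simp only [der, map_add, Pi.add_apply]
    ring

end Poly

lemma flat_eq_sum_finset {m : ℕ} (f : V → ZMod 2) (a : Fin m → V) (x : V) :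
    flat f a x = ∑ S : Finset (Fin m), f (x + ∑ i ∈ S, a i) := by
  refine Finset.sum_nbij' (fun u => Finset.univ.filter fun i => u i ≠ 0)
    (fun S i => if i ∈ S then 1 else 0) (by simp) (by simp) (fun u _ => ?_) (by simp)
    fun u _ => ?_
  · funext i
    rcases zmod2_cases (u i) with h | h <;> simp [h]
  · rw [comb, Finset.sum_filter]
    refine congrArg f (congrArg _ (Finset.sum_congr rfl fun i _ => ?_))
    rcases zmod2_cases (u i) with h | h <;> simp [h]

end

variable {n : ℕ}

lemma poly_pow_mul (i : Fin n) {m : ℕ} {f : (Fin n → ZMod 2) → ZMod 2} (hf : Poly m f) (k : ℕ) :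
    Poly (m + k) (fun x => x i ^ k * f x) := by
  induction k with
  | zero => simpa using hf
  | succ k ih =>
    rw [show (fun x => x i ^ (k + 1) * f x) =
      fun x => (LinearMap.proj i : Module.Dual (ZMod 2) (Fin n → ZMod 2)) x * (x i ^ k * f x) from
        funext fun x => by rw [LinearMap.proj_apply, pow_succ]; ring]
    exact ih.dual_mul _

lemma poly_prod_pow (s : Fin n → ℕ) (S : Finset (Fin n)) :
    Poly (1 + ∑ i ∈ S, s i) (fun x : Fin n → ZMod 2 => ∏ i ∈ S, x i ^ s i) := by
  induction S using Finset.induction_on with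
  | empty => exact poly_succ.2 fun b => poly_zero.2 (by funext x; simp [der, ZModModule.add_self])
  | insert i S hi ih =>
    simp only [Finset.sum_insert hi, Finset.prod_insert hi]
    rw [add_left_comm, add_comm (s i)]
    exact poly_pow_mul i ih _

lemma poly_of_degLE {d : ℕ} {g : (Fin n → ZMod 2) → ZMod 2} (hg : degLE n d g) :
    Poly (d + 1) g := by
  obtain ⟨p, hp, hpg⟩ := hg
  obtain rfl : (fun x => MvPolynomial.eval x p) = g := funext hpg
  simp only [MvPolynomial.eval_eq']
  refine Poly.sum _ _ fun s hs => Poly.const_mul ((poly_prod_pow s Finset.univ).mono ?_) _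
  have h := MvPolynomial.le_totalDegree hs
  rw [Finsupp.sum_fintype _ _ fun _ => rfl] at h
  omega

/-- The indicator vector of a set of coordinates. -/
def ind (T : Finset (Fin n)) : Fin n → ZMod 2 := ∑ i ∈ T, Pi.single i 1

lemma ind_filter (x : Fin n → ZMod 2) : ind (Finset.univ.filter fun i => x i ≠ 0) = x := by
  funext j
  rw [ind, Finset.sum_apply, Finset.sum_pi_single]
  rcases zmod2_cases (x j) with h | h <;> simp [h]

/-- The coefficient of the monomial indexed by `S` in the multilinear expansion of `f`. -/
def coef (f : (Fin n → ZMod 2) → ZMod 2) (S : Finset (Fin n)) : ZMod 2 :=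
  ∑ T ∈ S.powerset, f (ind T)

lemma coef_eq_flat (f : (Fin n → ZMod 2) → ZMod 2) (S : Finset (Fin n)) :
    coef f S = flat f (fun j => Pi.single (S.orderEmbOfFin rfl j) 1) 0 := by
  rw [flat_eq_sum_finset]
  symm
  refine Finset.sum_nbij (fun T => T.map (S.orderEmbOfFin rfl).toEmbedding) (fun T _ => ?_)
    (fun T _ T' _ h => Finset.map_injective _ h) (fun T hT => ?_) fun T _ => ?_
  · rw [Finset.mem_powerset]
    intro i hi
    obtain ⟨j, -, rfl⟩ := Finset.mem_map.1 hi
    exact Finset.orderEmbOfFin_mem S rfl j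
  · refine ⟨Finset.univ.filter fun j => S.orderEmbOfFin rfl j ∈ T, by simp, ?_⟩
    ext i
    simp only [Finset.mem_map, Finset.mem_filter, Finset.mem_univ, true_and]
    constructor
    · rintro ⟨j, hj, rfl⟩
      exact hj
    · intro hi
      have : i ∈ Set.range (S.orderEmbOfFin rfl) := by
        rw [Finset.range_orderEmbOfFin]
        exact Finset.mem_powerset.1 hT hi
      obtain ⟨j, rfl⟩ := this
      exact ⟨j, hi, rfl⟩
  · rw [zero_add, ind, Finset.sum_map]
    rfl

lemma sum_coef (f : (Fin n → ZMod 2) → ZMod 2) (A : Finset (Fin n)) :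
    ∑ S ∈ A.powerset, coef f S = f (ind A) := by
  have h1 : ∑ S ∈ A.powerset, coef f S =
      ∑ T ∈ A.powerset, ∑ S ∈ Finset.Icc T A, f (ind T) := by
    refine Finset.sum_comm' fun S T => ?_
    simp only [Finset.mem_powerset, Finset.mem_Icc]
    exact ⟨fun h => ⟨⟨h.2, h.1⟩, h.2.trans h.1⟩, fun h => ⟨h.1.2, h.1.1⟩⟩
  rw [h1, Finset.sum_eq_single_of_mem A (Finset.mem_powerset_self A)]
  · simp
  · intro T hT hTA
    rw [Finset.mem_powerset] at hT
    obtain ⟨k, hk⟩ := Nat.exists_eq_succ_of_ne_zero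
      (Nat.sub_pos_of_lt (Finset.card_lt_card (hT.ssubset_of_ne hTA))).ne'
    rw [Finset.sum_const, Finset.card_Icc_finset hT, hk, pow_succ, mul_nsmul, two_nsmul,
      ZModModule.add_self]

lemma Poly.degLE {d : ℕ} {f : (Fin n → ZMod 2) → ZMod 2} (hf : Poly (d + 1) f) :
    degLE n d f := by
  refine ⟨∑ S ∈ Finset.univ.filter fun S : Finset (Fin n) => S.card ≤ d,
    MvPolynomial.C (coef f S) * ∏ i ∈ S, MvPolynomial.X i, ?_, fun x => ?_⟩
  · refine MvPolynomial.totalDegree_finsetSum_le fun S hS => ?_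
    refine (MvPolynomial.totalDegree_mul _ _).trans ?_
    rw [MvPolynomial.totalDegree_C, zero_add]
    refine (MvPolynomial.totalDegree_finsetProd _ _).trans ?_
    simpa using (Finset.mem_filter.1 hS).2
  · set A := Finset.univ.filter fun i => x i ≠ 0 with hA
    have h1 : ∀ S : Finset (Fin n), ∏ i ∈ S, x i = if S ⊆ A then 1 else 0 := fun S => by
      split_ifs with h
      · exact Finset.prod_eq_one fun i hi => zmod2_ne_zero.1 (Finset.mem_filter.1 (h hi)).2
      · obtain ⟨i, hi, hiA⟩ := Finset.not_subset.1 h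
        exact Finset.prod_eq_zero hi (by simpa [hA] using hiA)
    simp only [map_sum, map_mul, MvPolynomial.eval_C, map_prod, MvPolynomial.eval_X, h1]
    rw [Finset.sum_filter_of_ne]
    · rw [← congrArg f (ind_filter x), ← hA, ← sum_coef f A]
      simp only [mul_ite, mul_one, mul_zero]
      rw [← Finset.sum_filter]
      refine Finset.sum_congr ?_ fun _ _ => rfl
      ext S
      simp [hA]
    · intro S _ hS
      by_contra hd
      refine hS ?_
      rw [coef_eq_flat, hf.mono (by omega), zero_mul]

end FlatTest

namespace FlatTest

lemma one_sub_le_rpow_two_pow {ρ : ℝ} (h0 : 0 ≤ ρ) (h1 : ρ ≤ 1 / 4) (d : ℕ) :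
    1 - 2 * ρ / 2 ^ d ≤ (1 - 2 * ρ) ^ ((1 : ℝ) / 2 ^ (d + 1)) := by
  have hM : (2 : ℝ) ^ (d + 1) = 2 * 2 ^ d := by ring
  have hD : (1 : ℝ) ≤ 2 ^ d := one_le_pow₀ (by norm_num)
  have hs : 0 ≤ 1 - 2 * ρ / 2 ^ d := by
    rw [sub_nonneg, div_le_one (by positivity)]
    linarith
  have h2 : (1 - 2 * ρ / 2 ^ d) ^ 2 ^ (d + 1) ≤ 1 - 2 * ρ := by
    have h3 : 1 - 2 * ρ / 2 ^ d ≤ Real.exp (-(2 * ρ / 2 ^ d)) := by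
      linarith [Real.add_one_le_exp (-(2 * ρ / 2 ^ d))]
    refine (pow_le_pow_left₀ hs h3 _).trans ?_
    rw [← Real.exp_nat_mul, show ((2 ^ (d + 1) : ℕ) : ℝ) * -(2 * ρ / 2 ^ d) = -(4 * ρ) by
      push_cast; rw [hM]; field_simp; ring, Real.exp_neg]
    have h4 := Real.add_one_le_exp (4 * ρ)
    rw [inv_le_iff_one_le_mul₀ (Real.exp_pos _)]
    nlinarith
  rw [one_div, Real.le_rpow_inv_iff_of_pos hs (by linarith) (by positivity)]
  exact_mod_cast h2

lemma rpow_two_pow_le {ρ : ℝ} (h1 : ρ ≤ 1 / 2) (d : ℕ) :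
    (1 - 2 * ρ) ^ ((1 : ℝ) / 2 ^ (d + 1)) ≤ 1 - ρ / 2 ^ d := by
  have hD : (1 : ℝ) ≤ 2 ^ (d + 1) := one_le_pow₀ (by norm_num)
  have h := rpow_one_add_le_one_add_mul_self (s := -(2 * ρ)) (p := 1 / 2 ^ (d + 1))
    (by linarith) (by positivity) (by rw [div_le_one (by positivity)]; exact hD)
  convert h using 1
  · rw [← sub_eq_add_neg]
  · rw [pow_succ]
    field_simp
    ring

lemma le_of_le_rpow_two_pow {ρ ε : ℝ} (hρ : ρ ≤ 1 / 2) (d : ℕ)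
    (h : 1 - ε / 2 ^ d ≤ (1 - 2 * ρ) ^ ((1 : ℝ) / 2 ^ (d + 1))) : ρ ≤ ε := by
  have h' := h.trans (rpow_two_pow_le hρ d)
  have := (div_le_div_iff_of_pos_right (show (0 : ℝ) < 2 ^ d by positivity)).1
    (sub_le_sub_iff_left 1 |>.1 h')
  exact this

variable {n d : ℕ}

lemma card_fun_fin (n : ℕ) : Fintype.card (Fin n → ZMod 2) = 2 ^ n := by
  simp [ZMod.card]

lemma Rej0_eq (f : (Fin n → ZMod 2) → ZMod 2) :
    Rej0 n d f = rej (d + 1) f / (2 ^ n * (2 ^ n) ^ (d + 1)) := by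
  simp only [Rej0, rej, flat_eq_sum_finset, zmod2_ne_zero]

lemma Rej0_nonneg (f : (Fin n → ZMod 2) → ZMod 2) : 0 ≤ Rej0 n d f := by
  rw [Rej0_eq]
  positivity

lemma Rej0_le_half (f : (Fin n → ZMod 2) → ZMod 2) : Rej0 n d f ≤ 1 / 2 := by
  have h : (2 * rej (d + 1) f : ℝ) ≤ (2 ^ n) ^ (d + 2) := by
    have := two_mul_rej_succ_le d f
    rw [card_fun_fin] at this
    exact_mod_cast this
  rw [Rej0_eq, div_le_div_iff₀ (by positivity) two_pos, ← pow_succ']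
  linarith

lemma Rej0_le_hdist {f g : (Fin n → ZMod 2) → ZMod 2} (hg : degLE n d g) :
    Rej0 n d f ≤ 2 ^ (d + 1) * hdist n f g := by
  have h := rej_le_dist (poly_of_degLE hg) (f := f)
  rw [card_fun_fin] at h
  push_cast at h
  rw [Rej0_eq, hdist, ← mul_div_assoc, div_le_div_iff₀ (by positivity) (by positivity)]
  change _ ≤ 2 ^ (d + 1) * (dist f g : ℝ) * _
  have := mul_le_mul_of_nonneg_right h (show (0 : ℝ) ≤ 2 ^ n by positivity)
  linarith

lemma Rej0_le_deltaD (f : (Fin n → ZMod 2) → ZMod 2) :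
    Rej0 n d f ≤ 2 ^ (d + 1) * deltaD n d f := by
  rw [mul_comm, ← div_le_iff₀ (by positivity)]
  refine le_csInf ⟨_, 0, (Poly.zero_fun _).degLE, rfl⟩ ?_
  rintro _ ⟨g, hg, rfl⟩
  rw [div_le_iff₀ (by positivity), mul_comm]
  exact Rej0_le_hdist hg

lemma deltaD_le_hdist {f g : (Fin n → ZMod 2) → ZMod 2} (hg : degLE n d g) :
    deltaD n d f ≤ hdist n f g := by
  refine csInf_le ⟨0, ?_⟩ ⟨g, hg, rfl⟩
  rintro _ ⟨g, -, rfl⟩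
  unfold hdist
  positivity

lemma deltaD_le_Rej0 {f : (Fin n → ZMod 2) → ZMod 2} (hf : Rej0 n d f ≤ 1 / 2048) :
    2 ^ d * deltaD n d f ≤ Rej0 n d f := by
  have hN : (0 : ℝ) < 2 ^ n := by positivity
  obtain ⟨g, hg, hgd⟩ := exists_poly_close d n _ (card_fun_fin n) f (by
    rw [Rej0_eq, div_le_div_iff₀ (by positivity) (by norm_num)] at hf
    rw [card_fun_fin]
    push_cast
    have : (0 : ℝ) < 146 * 2 ^ d * (2 ^ n) ^ (d + 1) := by positivity
    linarith)
  refine (mul_le_mul_of_nonneg_left (deltaD_le_hdist hg.degLE) (by positivity)).trans ?_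
  have h := dist_le_rej hg (f := f)
  rw [card_fun_fin] at h hgd
  push_cast at h hgd
  change 2 ^ d * ((dist f g : ℝ) / 2 ^ n) ≤ _
  rw [Rej0_eq, ← mul_div_assoc, div_le_div_iff₀ hN (by positivity)]
  set e : ℝ := (dist f g : ℝ) with he
  set N : ℝ := 2 ^ n
  have he0 : 0 ≤ e := Nat.cast_nonneg _
  have h1 : 2 ^ (d + 1) * e * N ^ (d + 1) * (N / 2) ≤
      2 ^ (d + 1) * e * N ^ (d + 1) * (N - 2 ^ (d + 1) * e) :=
    mul_le_mul_of_nonneg_left (by rw [pow_succ]; linarith) (by positivity)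
  have h2 : (2 : ℝ) ^ (d + 1) = 2 * 2 ^ d := by ring
  rw [h2] at h h1
  linarith

end FlatTest

theorem statement1 :
    ∃ ε c₁ c₂ : ℝ, 0 < ε ∧ 0 < c₁ ∧ 0 < c₂ ∧
      ∀ (d n : ℕ), d + 1 ≤ n → ∀ f : (Fin n → ZMod 2) → ZMod 2,
        1 - ε / 2 ^ d ≤ gowersNorm n d f →
          c₁ * (1 - gowersNorm n d f) ≤ deltaD n d f ∧
          deltaD n d f ≤ c₂ * (1 - gowersNorm n d f) := by
  refine ⟨1 / 2048, 1 / 4, 1, by norm_num, by norm_num, one_pos, fun d n _ f hf => ?_⟩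
  have hD : (0 : ℝ) < 2 ^ d := by positivity
  have h0 := FlatTest.Rej0_nonneg (d := d) f
  have h1 := FlatTest.Rej0_le_half (d := d) f
  have h2 := FlatTest.le_of_le_rpow_two_pow h1 d hf
  have h3 := FlatTest.one_sub_le_rpow_two_pow h0 (by linarith) d
  have h4 := FlatTest.rpow_two_pow_le h1 d
  have h5 := FlatTest.Rej0_le_deltaD (d := d) f
  have h6 := FlatTest.deltaD_le_Rej0 h2
  change _ ≤ gowersNorm n d f at h3
  change gowersNorm n d f ≤ _ at h4
  rw [mul_comm, ← le_div_iff₀ hD] at h6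
  have h7 : Rej0 n d f / 2 ^ d ≤ 2 * deltaD n d f := by
    rw [div_le_iff₀ hD]
    rw [pow_succ] at h5
    linarith
  rw [mul_div_assoc] at h3
  constructor <;> linarith

end
end
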